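/- A totally umbilical surface in any of Thurston's eight 3-dimensional geometries (ℝ³, S³, H³, S²×ℝ, H²×ℝ, SL~(2,ℝ), Nil, Sol) is proper biharmonic if and only if it is a part of S²(1/√2) in S³. -/

import Mathlib

/-!
Coordinate-based Riemannian geometry on charts `ℝⁿ`, enough to express mean
curvature, second fundamental forms, curvature tensors and the (bi)tension
fields of isometric immersions, as used in
"Constant mean curvature and totally umbilical biharmonic surfaces in
3-dimensional geometries".
-/

noncomputable section

open scoped BigOperators

/-- A point of the coordinate chart `ℝⁿ`. -/
abbrev Pt (n : ℕ) := Fin n → ℝ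

/-- A Riemannian metric on (an open part of) `ℝⁿ`, given by its coordinate matrix. -/
abbrev Met (n : ℕ) := Pt n → Matrix (Fin n) (Fin n) ℝ

/-- A vector field on `ℝⁿ`, in coordinates. -/
abbrev VF (n : ℕ) := Pt n → Pt n

/-- The inner product of tangent vectors `v`, `w` at the point `p`, w.r.t. `g`. -/
def gip {n : ℕ} (g : Met n) (p v w : Pt n) : ℝ := ∑ i, ∑ j, g p i j * v i * w j

/-- `g` is a Riemannian metric: smooth, symmetric and positive definite. -/
structure IsRiemannian {n : ℕ} (g : Met n) : Prop where
  smooth : ∀ i j, ContDiff ℝ (⊤ : ℕ∞) fun p => g p i j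
  symm : ∀ p i j, g p i j = g p j i
  posdef : ∀ p v, v ≠ 0 → 0 < gip g p v v

/-- Christoffel symbols `Γ^k_{ij}` of the Levi-Civita connection of `g`. -/
def christoffel {n : ℕ} (g : Met n) (p : Pt n) (k i j : Fin n) : ℝ :=
  (1 / 2) * ∑ l, (g p)⁻¹ k l *
    (fderiv ℝ (fun q => g q j l) p (Pi.single i 1)
      + fderiv ℝ (fun q => g q i l) p (Pi.single j 1)
      - fderiv ℝ (fun q => g q i j) p (Pi.single l 1))

/-- The Levi-Civita covariant derivative `∇_X Y` of vector fields, in coordinates. -/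
def cov {n : ℕ} (g : Met n) (X Y : VF n) : VF n := fun p k =>
  fderiv ℝ (fun q => Y q k) p (X p) + ∑ i, ∑ j, christoffel g p k i j * X p i * Y p j

/-- The Lie bracket `[X, Y]` of vector fields. -/
def lieB {n : ℕ} (X Y : VF n) : VF n := fun p k =>
  fderiv ℝ (fun q => Y q k) p (X p) - fderiv ℝ (fun q => X q k) p (Y p)

/-- The curvature operator `R(X,Y)Z = ∇_X ∇_Y Z − ∇_Y ∇_X Z − ∇_{[X,Y]} Z`. -/
def curvOp {n : ℕ} (g : Met n) (X Y Z : VF n) : VF n := fun p =>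
  cov g X (cov g Y Z) p - cov g Y (cov g X Z) p - cov g (lieB X Y) Z p

/-- The curvature tensor evaluated on tangent vectors at `p` (via constant extensions). -/
def curvPt {n : ℕ} (g : Met n) (p v w z : Pt n) : Pt n :=
  curvOp g (fun _ => v) (fun _ => w) (fun _ => z) p

/-- The Ricci curvature `Ric(v, w) = trace (z ↦ R(z, v) w)` at `p`; for the Levi-Civita
connection of a Riemannian metric this agrees with `Σᵢ ⟨R(v, eᵢ) eᵢ, w⟩` for any
orthonormal frame `{eᵢ}`. -/
def ricci {n : ℕ} (g : Met n) (p v w : Pt n) : ℝ :=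
  ∑ k, curvPt g p (Pi.single k 1) v w k

/-- The differential of `φ` at `u`, applied to the `a`-th coordinate direction. -/
def dmap {m n : ℕ} (φ : Pt m → Pt n) (u : Pt m) (a : Fin m) : Pt n := fun k =>
  fderiv ℝ (fun q => φ q k) u (Pi.single a 1)

/-- The pushforward `dφ_u(v)` of a tangent vector of the domain. -/
def push {m n : ℕ} (φ : Pt m → Pt n) (u : Pt m) (v : Pt m) : Pt n := fun k =>
  fderiv ℝ (fun q => φ q k) u v

/-- The first fundamental form (induced metric) of the immersion `φ`. -/
def fff {m n : ℕ} (g : Met n) (φ : Pt m → Pt n) : Met m := fun u =>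
  Matrix.of fun a b => gip g (φ u) (dmap φ u a) (dmap φ u b)

/-- `φ` is a smooth immersion. -/
def IsImmersion {m n : ℕ} (φ : Pt m → Pt n) : Prop :=
  (∀ k, ContDiff ℝ (⊤ : ℕ∞) fun u => φ u k) ∧ ∀ u, LinearIndependent ℝ (dmap φ u)

/-- `ξ` is a (smooth) unit normal vector field along the immersion `φ`. -/
def IsUnitNormal {m n : ℕ} (g : Met n) (φ ξ : Pt m → Pt n) : Prop :=
  (∀ k, ContDiff ℝ (⊤ : ℕ∞) fun u => ξ u k) ∧ (∀ u, gip g (φ u) (ξ u) (ξ u) = 1) ∧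
    ∀ u a, gip g (φ u) (ξ u) (dmap φ u a) = 0

/-- The second fundamental form `h_{ab} = ⟨∇^N_{∂_a} dφ(∂_b), ξ⟩` of `φ` w.r.t. `ξ`. -/
def sff {m n : ℕ} (g : Met n) (φ ξ : Pt m → Pt n) (u : Pt m) (a b : Fin m) : ℝ :=
  gip g (φ u)
    (fun k => fderiv ℝ (fun q => dmap φ q b k) u (Pi.single a 1)
      + ∑ i, ∑ j, christoffel g (φ u) k i j * dmap φ u a i * dmap φ u b j)
    (ξ u)

/-- The shape operator `A^a_b = G^{ac} h_{cb}` of `φ` w.r.t. `ξ` (`G` the induced metric). -/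
def shapeOp {m n : ℕ} (g : Met n) (φ ξ : Pt m → Pt n) (u : Pt m) (a b : Fin m) : ℝ :=
  ∑ c, (fff g φ u)⁻¹ a c * sff g φ ξ u c b

/-- The mean curvature `H = (1/m) ⋅ trace A` of the hypersurface `φ` w.r.t. `ξ`. -/
def meanCurv {m n : ℕ} (g : Met n) (φ ξ : Pt m → Pt n) (u : Pt m) : ℝ :=
  (1 / (m : ℝ)) * ∑ a, shapeOp g φ ξ u a a

/-- The squared norm `|A|²` of the shape operator (= of the second fundamental form). -/
def normA2 {m n : ℕ} (g : Met n) (φ ξ : Pt m → Pt n) (u : Pt m) : ℝ :=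
  ∑ a, ∑ b, shapeOp g φ ξ u a b * shapeOp g φ ξ u b a

/-- `φ` is totally umbilical w.r.t. `ξ`: at every point both principal curvatures are
equal, i.e. the second fundamental form is a scalar multiple of the induced metric
(equivalently, the shape operator is a scalar multiple of the identity). -/
def IsTotallyUmbilical {m n : ℕ} (g : Met n) (φ ξ : Pt m → Pt n) : Prop :=
  ∃ lam : Pt m → ℝ, ∀ u a b, sff g φ ξ u a b = lam u * fff g φ u a b

/-- The tension field `τ(φ) = Trace_g ∇ dφ` of the isometric immersion `φ`
(the domain carrying the induced metric). -/
def tension {m n : ℕ} (g : Met n) (φ : Pt m → Pt n) (u : Pt m) : Pt n := fun k =>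
  ∑ a, ∑ b, (fff g φ u)⁻¹ a b *
    (fderiv ℝ (fun q => dmap φ q b k) u (Pi.single a 1)
      - ∑ c, christoffel (fff g φ) u c a b * dmap φ u c k
      + ∑ i, ∑ j, christoffel g (φ u) k i j * dmap φ u a i * dmap φ u b j)

/-- The pull-back covariant derivative `∇^φ_{∂_a} V` of a vector field `V` along `φ`. -/
def covAlong {m n : ℕ} (g : Met n) (φ : Pt m → Pt n) (V : Pt m → Pt n) (a : Fin m) :
    Pt m → Pt n := fun u k =>
  fderiv ℝ (fun q => V q k) u (Pi.single a 1)
    + ∑ i, ∑ j, christoffel g (φ u) k i j * dmap φ u a i * V u j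

/-- The bitension field
`τ₂(φ) = Trace_g (∇^φ ∇^φ − ∇^φ_{∇^M}) τ(φ) − Trace_g R^N(dφ, τ(φ)) dφ`. -/
def bitension {m n : ℕ} (g : Met n) (φ : Pt m → Pt n) (u : Pt m) : Pt n := fun k =>
  (∑ a, ∑ b, (fff g φ u)⁻¹ a b *
      (covAlong g φ (covAlong g φ (tension g φ) b) a u k
        - ∑ c, christoffel (fff g φ) u c a b * covAlong g φ (tension g φ) c u k))
    - ∑ a, ∑ b, (fff g φ u)⁻¹ a b *
        curvPt g (φ u) (dmap φ u a) (tension g φ u) (dmap φ u b) k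

/-- `φ` is a biharmonic isometric immersion: its bitension field vanishes.  (This is the
Euler–Lagrange characterisation of the critical points of the bienergy
`E²(φ,Ω) = (1/2)∫_Ω |τ(φ)|²` for every compact `Ω`.) -/
def IsBiharmonic {m n : ℕ} (g : Met n) (φ : Pt m → Pt n) : Prop := ∀ u, bitension g φ u = 0

/-- `φ` is minimal (equivalently, harmonic): its tension field vanishes, i.e. `H ≡ 0`. -/
def IsMinimal {m n : ℕ} (g : Met n) (φ : Pt m → Pt n) : Prop := ∀ u, tension g φ u = 0

/-- `φ` is proper biharmonic: biharmonic and not minimal. -/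
def IsProperBiharmonic {m n : ℕ} (g : Met n) (φ : Pt m → Pt n) : Prop :=
  IsBiharmonic g φ ∧ ¬IsMinimal g φ

/-! ### The Bianchi–Cartan–Vranceanu spaces `M³_{m,l}`, Sol, hyperbolic and flat space -/

/-- `F = 1 + m (x² + y²)`. -/
def bcvF (m : ℝ) (p : Pt 3) : ℝ := 1 + m * (p 0 ^ 2 + p 1 ^ 2)

/-- The coordinate covector of the one-form `dz + (l/2)(y dx − x dy)/F`. -/
def bcvω (m l : ℝ) (p : Pt 3) : Pt 3 :=
  ![l * p 1 / (2 * bcvF m p), -(l * p 0) / (2 * bcvF m p), 1]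

/-- The Bianchi–Cartan–Vranceanu metric
`g = (dx² + dy²)/(1 + m(x²+y²))² + (dz + (l/2)(y dx − x dy)/(1 + m(x²+y²)))²` on `ℝ³`. -/
def bcvMet (m l : ℝ) : Met 3 := fun p =>
  Matrix.of fun i j =>
    (if i = j ∧ (i : ℕ) < 2 then 1 / bcvF m p ^ 2 else 0) + bcvω m l p i * bcvω m l p j

/-- The frame `E₁ = F ∂_x − (l y/2) ∂_z`, `E₂ = F ∂_y + (l x/2) ∂_z`, `E₃ = ∂_z`
on the BCV space `M³_{m,l}`. -/
def bcvE (m l : ℝ) : Fin 3 → VF 3 :=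
  ![fun p => ![bcvF m p, 0, -(l * p 1) / 2],
    fun p => ![0, bcvF m p, l * p 0 / 2],
    fun _ => ![0, 0, 1]]

/-- The base metric `h = (dx² + dy²)/(1 + m(x²+y²))²` on `ℝ²` of the BCV Riemannian
submersion `π : M³_{m,l} → (ℝ², h)`, `π(x,y,z) = (x,y)`. -/
def bcvBase (m : ℝ) : Met 2 := fun p =>
  Matrix.of fun i j => if i = j then 1 / (1 + m * (p 0 ^ 2 + p 1 ^ 2)) ^ 2 else 0

/-- The geodesic curvature of a unit-speed curve `α` in `(ℝ², h)`, with respect to the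
unit normal obtained by rotating `α'` by `+π/2` (a Euclidean rotation, which is also an
`h`-rotation since `h` is conformal to the flat metric). -/
def geodCurv (m : ℝ) (α : ℝ → Pt 2) (s : ℝ) : ℝ :=
  gip (bcvBase m) (α s)
    (fun k => deriv (fun t => deriv α t k) s
      + ∑ i, ∑ j, christoffel (bcvBase m) (α s) k i j * deriv α s i * deriv α s j)
    ![-deriv α s 1, deriv α s 0]

/-- `φ` parametrises part of the Hopf cylinder `π⁻¹(α(I))` over a circle of radius
`1/√(8m − l²)` in the base sphere `S²(1/(2√m))`, identified with `(ℝ², h)`.  (In the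
base sphere, which has Gaussian curvature `4m` and extrinsic normal curvature `2√m`,
the circles of radius `1/√(8m − l²)` are exactly the curves of constant geodesic
curvature `κ₀` with `κ₀² = (8m − l²) − 4m = 4m − l²`.) -/
def PartOfHopfCylinderOverCircle (m l : ℝ) (φ : Pt 2 → Pt 3) : Prop :=
  ∃ α : ℝ → Pt 2, ContDiff ℝ (⊤ : ℕ∞) α ∧
    (∀ s, gip (bcvBase m) (α s) (deriv α s) (deriv α s) = 1) ∧
    (∃ κ₀ : ℝ, κ₀ ^ 2 = 4 * m - l ^ 2 ∧ ∀ s, geodCurv m α s = κ₀) ∧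
    ∀ u, ∃ s, φ u 0 = α s 0 ∧ φ u 1 = α s 1

/-- The Sol metric `g_{Sol} = e^{2z} dx² + e^{−2z} dy² + dz²` on `ℝ³`. -/
def solMet : Met 3 := fun p =>
  Matrix.of fun i j =>
    if i = j then
      if (i : ℕ) = 0 then Real.exp (2 * p 2)
      else if (i : ℕ) = 1 then Real.exp (-(2 * p 2)) else 1
    else 0

/-- The orthonormal frame `E₁ = e^{−z} ∂_x`, `E₂ = e^{z} ∂_y`, `E₃ = ∂_z` on Sol space. -/
def solE : Fin 3 → VF 3 :=
  ![fun p => ![Real.exp (-p 2), 0, 0],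
    fun p => ![0, Real.exp (p 2), 0],
    fun _ => ![0, 0, 1]]

/-- Hyperbolic 3-space `H³` in horospherical coordinates: `g = e^{2z}(dx² + dy²) + dz²`. -/
def hypMet : Met 3 := fun p =>
  Matrix.of fun i j => if i = j then (if (i : ℕ) < 2 then Real.exp (2 * p 2) else 1) else 0

/-- The flat metric on `ℝ³`. -/
def euclMet : Met 3 := fun _ => 1


/-- smooth at a point -/
abbrev SmAt {m : ℕ} (f : Pt m → ℝ) (u : Pt m) : Prop := ContDiffAt ℝ (⊤ : ℕ∞) f u

/-- partial derivative -/
abbrev pd {m : ℕ} (a : Fin m) (f : Pt m → ℝ) (u : Pt m) : ℝ := fderiv ℝ f u (Pi.single a 1)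

lemma SmAt.da {m : ℕ} {f : Pt m → ℝ} {u : Pt m} (h : SmAt f u) : DifferentiableAt ℝ f u :=
  h.differentiableAt (by simp)

lemma SmAt.fd {m : ℕ} {f : Pt m → ℝ} {u : Pt m} (h : SmAt f u) (v : Pt m) :
    SmAt (fun q => fderiv ℝ f q v) u := by
  have := ContDiffAt.fderiv_right (m := ((⊤ : ℕ∞) : WithTop ℕ∞)) h (by simp)
  exact this.clm_apply contDiffAt_const

lemma SmAt.det {m n : ℕ} {A : Pt m → Matrix (Fin n) (Fin n) ℝ} {u : Pt m}
    (h : ∀ i j, SmAt (fun q => A q i j) u) : SmAt (fun q => (A q).det) u := by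
  simp only [Matrix.det_apply]
  apply ContDiffAt.sum
  intro σ _
  apply ContDiffAt.const_smul
  apply contDiffAt_prod
  intro i _
  exact h _ _

lemma SmAt.inv_mat {m n : ℕ} {A : Pt m → Matrix (Fin n) (Fin n) ℝ} {u : Pt m}
    (h : ∀ i j, SmAt (fun q => A q i j) u) (hd : (A u).det ≠ 0) (i j : Fin n) :
    SmAt (fun q => (A q)⁻¹ i j) u := by
  simp only [Matrix.inv_def, Ring.inverse_eq_inv', Matrix.smul_apply, smul_eq_mul,
    Matrix.adjugate_apply]
  refine ContDiffAt.mul (ContDiffAt.inv (SmAt.det h) hd) ?_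
  apply SmAt.det (A := fun q => (A q).updateRow j (Pi.single i 1))
  intro k l
  by_cases hk : k = j
  · subst hk
    simp only [Matrix.updateRow_self]
    exact contDiffAt_const
  · simp only [Matrix.updateRow_ne hk]
    exact h _ _

/-- lowered Christoffel symbols -/
def lowC {n : ℕ} (g : Met n) (p : Pt n) (l i j : Fin n) : ℝ :=
  (1 / 2) * (pd i (fun q => g q j l) p + pd j (fun q => g q i l) p - pd l (fun q => g q i j) p)

lemma inv_lower {n : ℕ} (A : Matrix (Fin n) (Fin n) ℝ) (hd : A.det ≠ 0) (x : Fin n → ℝ)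
    (l : Fin n) : ∑ k, A l k * ∑ r, A⁻¹ k r * x r = x l := by
  have h : A * A⁻¹ = 1 := Matrix.mul_nonsing_inv A (isUnit_iff_ne_zero.mpr hd)
  have h2 : A.mulVec (A⁻¹.mulVec x) = x := by
    rw [Matrix.mulVec_mulVec, h, Matrix.one_mulVec]
  exact congrFun h2 l

lemma lower {n : ℕ} (g : Met n) (p : Pt n) (hd : (g p).det ≠ 0) (l i j : Fin n) :
    ∑ k, g p l k * christoffel g p k i j = lowC g p l i j := by
  rw [← inv_lower (g p) hd (fun l => lowC g p l i j) l]
  apply Finset.sum_congr rfl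
  intro k _
  congr 1
  simp only [christoffel, lowC, Finset.mul_sum]
  apply Finset.sum_congr rfl
  intro r _
  ring

lemma chris_symm {n : ℕ} (g : Met n) (p : Pt n)
    (hs : ∀ i j, (fun q => g q i j) =ᶠ[nhds p] (fun q => g q j i)) (k i j : Fin n) :
    christoffel g p k i j = christoffel g p k j i := by
  simp only [christoffel]
  rw [(hs i j).fderiv_eq]
  congr 1
  apply Finset.sum_congr rfl
  intro r _
  ring

lemma chris_smooth {n : ℕ} (g : Met n) (p : Pt n) (h : ∀ i j, SmAt (fun q => g q i j) p)
    (hd : (g p).det ≠ 0) (k i j : Fin n) : SmAt (fun q => christoffel g q k i j) p := by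
  simp only [christoffel]
  apply ContDiffAt.mul contDiffAt_const
  apply ContDiffAt.sum
  intro l _
  apply ContDiffAt.mul (SmAt.inv_mat h hd _ _)
  exact (((h _ _).fd _).add ((h _ _).fd _)).sub ((h _ _).fd _)

/-- vector-valued derivative, componentwise -/
lemma fd_expand {f : Pt 3 → ℝ} {p : Pt 3} (v : Pt 3) :
    fderiv ℝ f p v = v 0 * pd 0 f p + v 1 * pd 1 f p + v 2 * pd 2 f p := by
  have : v = v 0 • (Pi.single 0 1 : Pt 3) + v 1 • (Pi.single 1 1 : Pt 3)
      + v 2 • (Pi.single 2 1 : Pt 3) := by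
    ext i; fin_cases i <;> simp
  conv_lhs => rw [this]
  simp only [map_add, map_smul, smul_eq_mul]

lemma sm_comp {φ : Pt 2 → Pt 3} {u : Pt 2} (hφ : ∀ k, SmAt (fun q => φ q k) u)
    {f : Pt 3 → ℝ} (hf : SmAt f (φ u)) : SmAt (fun q => f (φ q)) u :=
  ContDiffAt.comp u hf (contDiffAt_pi.mpr hφ)

lemma fd_comp {φ : Pt 2 → Pt 3} {u : Pt 2} (hφ : ∀ k, SmAt (fun q => φ q k) u)
    {f : Pt 3 → ℝ} (hf : SmAt f (φ u)) (a : Fin 2) :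
    pd a (fun q => f (φ q)) u = fderiv ℝ f (φ u) (dmap φ u a) := by
  have h1 : DifferentiableAt ℝ φ u := differentiableAt_pi.mpr fun k => (hφ k).da
  have h2 : fderiv ℝ (fun q => f (φ q)) u = (fderiv ℝ f (φ u)).comp (fderiv ℝ φ u) :=
    fderiv_comp u hf.da h1
  rw [pd, h2, ContinuousLinearMap.comp_apply]
  congr 1
  ext k
  simp only [dmap]
  rw [fderiv_pi (fun k => (hφ k).da)]
  rfl

lemma pd_mul {m : ℕ} {f h : Pt m → ℝ} {u : Pt m} (hf : SmAt f u) (hh : SmAt h u) (a : Fin m) :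
    pd a (fun q => f q * h q) u = pd a f u * h u + f u * pd a h u := by
  rw [pd, fderiv_fun_mul hf.da hh.da]
  simp only [add_apply, smul_apply, smul_eq_mul]
  ring

lemma pd_add {m : ℕ} {f h : Pt m → ℝ} {u : Pt m} (hf : SmAt f u) (hh : SmAt h u) (a : Fin m) :
    pd a (fun q => f q + h q) u = pd a f u + pd a h u := by
  rw [pd, fderiv_fun_add hf.da hh.da]
  rfl

lemma pd_sum {m n : ℕ} {f : Fin n → Pt m → ℝ} {u : Pt m} (hf : ∀ i, SmAt (f i) u) (a : Fin m) :
    pd a (fun q => ∑ i, f i q) u = ∑ i, pd a (f i) u := by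
  rw [pd, fderiv_fun_sum (fun i _ => (hf i).da)]
  simp

lemma pd_mul3 {m : ℕ} {f h r : Pt m → ℝ} {u : Pt m} (hf : SmAt f u) (hh : SmAt h u)
    (hr : SmAt r u) (a : Fin m) :
    pd a (fun q => f q * h q * r q) u =
      pd a f u * h u * r u + f u * pd a h u * r u + f u * h u * pd a r u := by
  rw [pd_mul (hf.mul hh) hr, pd_mul hf hh]; ring

lemma pd_congr {m : ℕ} {f h : Pt m → ℝ} {u : Pt m} {U : Set (Pt m)} (hU : IsOpen U) (hu : u ∈ U)
    (he : ∀ q ∈ U, f q = h q) (a : Fin m) : pd a f u = pd a h u := by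
  have : f =ᶠ[nhds u] h := by
    filter_upwards [hU.mem_nhds hu] with q hq using he q hq
  rw [pd, this.fderiv_eq]

lemma pd_comm {m : ℕ} {f : Pt m → ℝ} {u : Pt m} (hf : SmAt f u) (a b : Fin m) :
    pd a (fun q => pd b f q) u = pd b (fun q => pd a f q) u := by
  have hs : IsSymmSndFDerivAt ℝ f u := by
    apply ContDiffAt.isSymmSndFDerivAt hf
    simp only [minSmoothness_of_isRCLikeNormedField]
    exact WithTop.coe_le_coe.mpr (le_top : (2 : ℕ∞) ≤ ⊤)
  have h1 : DifferentiableAt ℝ (fderiv ℝ f) u :=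
    (ContDiffAt.fderiv_right (m := ((⊤ : ℕ∞) : WithTop ℕ∞)) hf (by simp)).differentiableAt (by simp)
  have key : ∀ v w : Pt m, fderiv ℝ (fun q => fderiv ℝ f q v) u w = fderiv ℝ (fderiv ℝ f) u w v := by
    intro v w
    rw [fderiv_clm_apply h1 (differentiableAt_const v)]
    simp
  simp only [pd]
  rw [key, key]
  exact hs _ _

structure Setup (g : Met 3) (φ ξ : Pt 2 → Pt 3) (lam : Pt 2 → ℝ) (U : Set (Pt 2)) (V : Set (Pt 3)) :
    Prop where
  oU : IsOpen U
  oV : IsOpen V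
  maps : ∀ u ∈ U, φ u ∈ V
  gsm : ∀ p ∈ V, ∀ i j, SmAt (fun q => g q i j) p
  gsymm : ∀ p i j, g p i j = g p j i
  gdet : ∀ p ∈ V, (g p).det ≠ 0
  imm : IsImmersion φ
  nor : IsUnitNormal g φ ξ
  umb : ∀ u a b, sff g φ ξ u a b = lam u * fff g φ u a b
  Gdet : ∀ u ∈ U, (fff g φ u).det ≠ 0

lemma gip_symm {n : ℕ} {g : Met n} (hs : ∀ p i j, g p i j = g p j i) (p v w : Pt n) :
    gip g p v w = gip g p w v := by
  simp only [gip]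
  rw [Finset.sum_comm]
  refine Finset.sum_congr rfl fun i _ => Finset.sum_congr rfl fun j _ => ?_
  rw [hs p i j]; ring

lemma gip_add_left {n : ℕ} (g : Met n) (p v w z : Pt n) :
    gip g p (v + w) z = gip g p v z + gip g p w z := by
  simp only [gip, ← Finset.sum_add_distrib, Pi.add_apply]
  refine Finset.sum_congr rfl fun i _ => Finset.sum_congr rfl fun j _ => ?_
  ring

lemma gip_smul_left {n : ℕ} (g : Met n) (p v z : Pt n) (c : ℝ) :
    gip g p (c • v) z = c * gip g p v z := by
  simp only [gip, Finset.mul_sum, Pi.smul_apply, smul_eq_mul]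
  refine Finset.sum_congr rfl fun i _ => Finset.sum_congr rfl fun j _ => ?_
  ring

lemma gip_add_right {n : ℕ} (g : Met n) (p v w z : Pt n) :
    gip g p z (v + w) = gip g p z v + gip g p z w := by
  simp only [gip, ← Finset.sum_add_distrib, Pi.add_apply]
  refine Finset.sum_congr rfl fun i _ => Finset.sum_congr rfl fun j _ => ?_
  ring

lemma gip_smul_right {n : ℕ} (g : Met n) (p v z : Pt n) (c : ℝ) :
    gip g p z (c • v) = c * gip g p z v := by
  simp only [gip, Finset.mul_sum, Pi.smul_apply, smul_eq_mul]
  refine Finset.sum_congr rfl fun i _ => Finset.sum_congr rfl fun j _ => ?_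
  ring

lemma gip_neg_left {n : ℕ} (g : Met n) (p v z : Pt n) :
    gip g p (-v) z = - gip g p v z := by
  have := gip_smul_left g p v z (-1); simpa using this

lemma gip_sub_left {n : ℕ} (g : Met n) (p v w z : Pt n) :
    gip g p (v - w) z = gip g p v z - gip g p w z := by
  rw [sub_eq_add_neg, gip_add_left, gip_neg_left]; ring

/-- Christoffel bilinear form -/
def GamV (g : Met 3) (p v w : Pt 3) : Pt 3 := fun k =>
  ∑ i, ∑ j, christoffel g p k i j * v i * w j

lemma gip_Gam {g : Met 3} (hs : ∀ p i j, g p i j = g p j i) (p v w z : Pt 3)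
    (hd : (g p).det ≠ 0) :
    gip g p (GamV g p v w) z = ∑ l, ∑ i, ∑ j, lowC g p l i j * v i * w j * z l := by
  simp only [← lower g p hd, gip, GamV, Fin.sum_univ_three]
  rw [hs p 1 0, hs p 2 0, hs p 2 1]
  ring

lemma gip_sm {g : Met 3} {φ X Y : Pt 2 → Pt 3} {u : Pt 2}
    (hφ : ∀ k, SmAt (fun q => φ q k) u)
    (hg : ∀ i j, SmAt (fun q => g q i j) (φ u))
    (hX : ∀ k, SmAt (fun q => X q k) u) (hY : ∀ k, SmAt (fun q => Y q k) u) :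
    SmAt (fun q => gip g (φ q) (X q) (Y q)) u := by
  simp only [gip]
  refine ContDiffAt.sum fun i _ => ContDiffAt.sum fun j _ => ?_
  exact ((sm_comp hφ (hg i j)).mul (hX i)).mul (hY j)

lemma compat {g : Met 3} {φ X Y : Pt 2 → Pt 3} {u : Pt 2}
    (hs : ∀ p i j, g p i j = g p j i)
    (hφ : ∀ k, SmAt (fun q => φ q k) u)
    (hg : ∀ i j, SmAt (fun q => g q i j) (φ u)) (hd : (g (φ u)).det ≠ 0)
    (hX : ∀ k, SmAt (fun q => X q k) u) (hY : ∀ k, SmAt (fun q => Y q k) u) (a : Fin 2) :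
    pd a (fun q => gip g (φ q) (X q) (Y q)) u =
      gip g (φ u) (covAlong g φ X a u) (Y u) + gip g (φ u) (X u) (covAlong g φ Y a u) := by
  have hc : ∀ X : Pt 2 → Pt 3, covAlong g φ X a u =
      (fun k => pd a (fun q => X q k) u) + GamV g (φ u) (dmap φ u a) (X u) := fun X => rfl
  rw [hc, hc, gip_add_left, gip_add_right, gip_symm hs _ (X u) (GamV _ _ _ _),
    gip_Gam hs _ _ _ _ hd, gip_Gam hs _ _ _ _ hd]
  have h3 : ∀ i j, SmAt (fun q => g (φ q) i j * X q i * Y q j) u := fun i j =>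
    ((sm_comp hφ (hg i j)).mul (hX i)).mul (hY j)
  have h4 : pd a (fun q => gip g (φ q) (X q) (Y q)) u =
      ∑ i, ∑ j, (fderiv ℝ (fun q => g q i j) (φ u) (dmap φ u a) * X u i * Y u j
        + g (φ u) i j * pd a (fun q => X q i) u * Y u j
        + g (φ u) i j * X u i * pd a (fun q => Y q j) u) := by
    simp only [gip]
    rw [pd_sum (fun i => ContDiffAt.sum fun j _ => h3 i j)]
    refine Finset.sum_congr rfl fun i _ => ?_
    rw [pd_sum (h3 i)]
    refine Finset.sum_congr rfl fun j _ => ?_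
    rw [pd_mul3 (sm_comp hφ (hg i j)) (hX i) (hY j)]
    rw [fd_comp hφ (f := fun p => g p i j) (hg i j)]
  rw [h4]
  have hps : ∀ k i j, pd k (fun q => g q i j) (φ u) = pd k (fun q => g q j i) (φ u) := by
    intro k i j; congr 1; congr 1; ext q; exact hs q i j
  have hfe : ∀ i j, fderiv ℝ (fun q => g q i j) (φ u) (dmap φ u a) =
      dmap φ u a 0 * pd 0 (fun q => g q i j) (φ u) + dmap φ u a 1 * pd 1 (fun q => g q i j) (φ u)
      + dmap φ u a 2 * pd 2 (fun q => g q i j) (φ u) := fun i j => fd_expand _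
  simp only [hfe, lowC, gip, Fin.sum_univ_three]
  rw [hps 0 1 0, hps 0 2 0, hps 0 2 1, hps 1 1 0, hps 1 2 0, hps 1 2 1, hps 2 1 0, hps 2 2 0,
    hps 2 2 1]
  ring

lemma curvPt_eq {g : Met 3} {p : Pt 3} (hΓ : ∀ k i j, SmAt (fun q => christoffel g q k i j) p)
    (v w z : Pt 3) (k : Fin 3) :
    curvPt g p v w z k =
      (∑ i, ∑ j, fderiv ℝ (fun q => christoffel g q k i j) p v * w i * z j)
      + GamV g p v (GamV g p w z) k
      - (∑ i, ∑ j, fderiv ℝ (fun q => christoffel g q k i j) p w * v i * z j)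
      - GamV g p w (GamV g p v z) k := by
  have hc : ∀ w : Pt 3, cov g (fun _ => w) (fun _ => z) = fun q => GamV g q w z := by
    intro w; ext q k; simp [cov, GamV]
  have hl : lieB (fun _ => v) (fun _ : Pt 3 => w) = fun _ => 0 := by
    ext q k; simp [lieB]
  have hf : ∀ v w : Pt 3, fderiv ℝ (fun q => GamV g q w z k) p v =
      ∑ i, ∑ j, fderiv ℝ (fun q => christoffel g q k i j) p v * w i * z j := by
    intro v w
    simp only [GamV]
    have hd : ∀ i j, DifferentiableAt ℝ (fun q => christoffel g q k i j) p := fun i j =>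
      (hΓ k i j).da
    have hd2 : ∀ i j, DifferentiableAt ℝ (fun q => christoffel g q k i j * w i * z j) p :=
      fun i j => ((hd i j).mul_const _).mul_const _
    rw [fderiv_fun_sum (fun i _ => DifferentiableAt.fun_sum fun j _ => hd2 i j)]
    rw [sum_apply]
    refine Finset.sum_congr rfl fun i _ => ?_
    rw [fderiv_fun_sum (fun j _ => hd2 i j), sum_apply]
    refine Finset.sum_congr rfl fun j _ => ?_
    rw [fderiv_mul_const ((hd i j).mul_const _), fderiv_mul_const (hd i j)]
    simp only [smul_apply, smul_eq_mul]
    ring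
  simp only [curvPt, curvOp, hc, hl, Pi.sub_apply]
  have h2 : ∀ v w : Pt 3, cov g (fun _ => v) (fun q => GamV g q w z) p k =
    fderiv ℝ (fun q => GamV g q w z k) p v + GamV g p v (GamV g p w z) k := fun v w => rfl
  rw [h2, h2, hf, hf]
  have h0 : GamV g p 0 z k = 0 := by simp [GamV]
  rw [h0]
  ring

lemma covAlong_sm {g : Met 3} {φ X : Pt 2 → Pt 3} {u : Pt 2}
    (hφ : ∀ k, SmAt (fun q => φ q k) u)
    (hΓ : ∀ k i j, SmAt (fun q => christoffel g q k i j) (φ u))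
    (hX : ∀ k, SmAt (fun q => X q k) u) (a : Fin 2) (k : Fin 3) :
    SmAt (fun q => covAlong g φ X a q k) u := by
  simp only [covAlong]
  refine ((hX k).fd _).add ?_
  refine ContDiffAt.sum fun i _ => ContDiffAt.sum fun j _ => ?_
  exact ((sm_comp hφ (hΓ k i j)).mul ((hφ i).fd _)).mul (hX j)

lemma curvComm {g : Met 3} {φ X : Pt 2 → Pt 3} {u : Pt 2}
    (hφ : ∀ k, SmAt (fun q => φ q k) u)
    (hΓ : ∀ k i j, SmAt (fun q => christoffel g q k i j) (φ u))
    (hX : ∀ k, SmAt (fun q => X q k) u) (a b : Fin 2) :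
    covAlong g φ (covAlong g φ X b) a u - covAlong g φ (covAlong g φ X a) b u =
      curvPt g (φ u) (dmap φ u a) (dmap φ u b) (X u) := by
  ext k
  rw [curvPt_eq hΓ]
  have h1 : ∀ a b, covAlong g φ (covAlong g φ X b) a u k =
      pd a (fun q => pd b (fun q => X q k) q) u +
      (∑ i, ∑ j, (fderiv ℝ (fun q => christoffel g q k i j) (φ u) (dmap φ u a) * dmap φ u b i * X u j
        + christoffel g (φ u) k i j * pd a (fun q => pd b (fun q => φ q i) q) u * X u j
        + christoffel g (φ u) k i j * dmap φ u b i * pd a (fun q => X q j) u))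
      + ∑ i, ∑ j, christoffel g (φ u) k i j * dmap φ u a i * covAlong g φ X b u j := by
    intro a b
    have e : covAlong g φ (covAlong g φ X b) a u k = pd a (fun q => pd b (fun q => X q k) q +
       ∑ i, ∑ j, christoffel g (φ q) k i j * dmap φ q b i * X q j) u
       + ∑ i, ∑ j, christoffel g (φ u) k i j * dmap φ u a i * covAlong g φ X b u j := rfl
    rw [e]
    have hs : ∀ i j, SmAt (fun q => christoffel g (φ q) k i j * dmap φ q b i * X q j) u :=
      fun i j => ((sm_comp hφ (hΓ k i j)).mul ((hφ i).fd _)).mul (hX j)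
    rw [pd_add ((hX k).fd _) (ContDiffAt.sum fun i _ => ContDiffAt.sum fun j _ => hs i j)]
    rw [pd_sum (fun i => ContDiffAt.sum fun j _ => hs i j)]
    congr 2
    refine Finset.sum_congr rfl fun i _ => ?_
    rw [pd_sum (hs i)]
    refine Finset.sum_congr rfl fun j _ => ?_
    rw [pd_mul3 (h := fun q => dmap φ q b i) (sm_comp hφ (hΓ k i j)) ((hφ i).fd _) (hX j)]
    rw [fd_comp hφ (f := fun p => christoffel g p k i j) (hΓ k i j)]
    rfl
  rw [Pi.sub_apply, h1, h1, pd_comm (hX k) a b]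
  have h5 : ∀ b j, covAlong g φ X b u j = pd b (fun q => X q j) u +
    GamV g (φ u) (dmap φ u b) (X u) j := fun b j => rfl
  have h6 : ∀ i, pd a (fun q => pd b (fun q => φ q i) q) u = pd b (fun q => pd a (fun q => φ q i) q) u
    := fun i => pd_comm (hφ i) a b
  have h7 : ∀ v w, GamV g (φ u) v w k = ∑ i, ∑ j, christoffel g (φ u) k i j * v i * w j :=
    fun v w => rfl
  simp only [h5, h6, h7, mul_add, Finset.sum_add_distrib]
  ring

namespace Setup
variable {g : Met 3} {φ ξ : Pt 2 → Pt 3} {lam : Pt 2 → ℝ} {U : Set (Pt 2)} {V : Set (Pt 3)}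

lemma phi_sm (S : Setup g φ ξ lam U V) (u : Pt 2) (k : Fin 3) : SmAt (fun q => φ q k) u :=
  (S.imm.1 k).contDiffAt

lemma xi_sm (S : Setup g φ ξ lam U V) (u : Pt 2) (k : Fin 3) : SmAt (fun q => ξ q k) u :=
  (S.nor.1 k).contDiffAt

lemma e_sm (S : Setup g φ ξ lam U V) (u : Pt 2) (a : Fin 2) (k : Fin 3) :
    SmAt (fun q => dmap φ q a k) u :=
  (S.phi_sm u k).fd _

lemma gam_sm (S : Setup g φ ξ lam U V) {u : Pt 2} (hu : u ∈ U) (k i j : Fin 3) :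
    SmAt (fun q => christoffel g q k i j) (φ u) :=
  chris_smooth g _ (S.gsm _ (S.maps u hu)) (S.gdet _ (S.maps u hu)) k i j

lemma G_sm (S : Setup g φ ξ lam U V) {u : Pt 2} (hu : u ∈ U) (a b : Fin 2) :
    SmAt (fun q => fff g φ q a b) u :=
  gip_sm (S.phi_sm u) (S.gsm _ (S.maps u hu)) (S.e_sm u a) (S.e_sm u b)

lemma G_symm (S : Setup g φ ξ lam U V) (u : Pt 2) (a b : Fin 2) :
    fff g φ u a b = fff g φ u b a := gip_symm S.gsymm _ _ _

lemma nondeg (S : Setup g φ ξ lam U V) {u : Pt 2} (hu : u ∈ U) {W : Pt 3}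
    (h1 : ∀ a, gip g (φ u) W (dmap φ u a) = 0) (h2 : gip g (φ u) W (ξ u) = 0) : W = 0 := by
  set M : Matrix (Fin 3) (Fin 3) ℝ := Matrix.of ![dmap φ u 0, dmap φ u 1, ξ u] with hM
  have hN : ∀ i j, (M * g (φ u) * M.transpose) i j = gip g (φ u) (M i) (M j) := by
    intro i j
    simp only [Matrix.mul_apply, Matrix.transpose_apply, gip, Fin.sum_univ_three]
    ring
  have hdet : (M * g (φ u) * M.transpose).det = (fff g φ u).det := by
    rw [Matrix.det_fin_three, Matrix.det_fin_two]
    simp only [hN]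
    have n1 := S.nor.2.1 u
    have n2 := S.nor.2.2 u
    have e0 : M 0 = dmap φ u 0 := rfl
    have e1 : M 1 = dmap φ u 1 := rfl
    have e2 : M 2 = ξ u := rfl
    rw [e0, e1, e2, gip_symm S.gsymm _ (dmap φ u 0) (ξ u), gip_symm S.gsymm _ (dmap φ u 1) (ξ u),
      n1, n2, n2]
    simp only [fff, Matrix.of_apply]
    ring
  have hd : (M * g (φ u)).det ≠ 0 := by
    intro h0
    apply S.Gdet u hu
    rw [← hdet, Matrix.det_mul, h0, zero_mul]
  apply Matrix.eq_zero_of_mulVec_eq_zero hd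
  ext i
  have : (M * g (φ u)).mulVec W i = gip g (φ u) (M i) W := by
    simp only [Matrix.mulVec, dotProduct, Matrix.mul_apply, gip, Fin.sum_univ_three]
    ring
  rw [this, gip_symm S.gsymm]
  fin_cases i
  · exact h1 0
  · exact h1 1
  · exact h2

lemma sff_eq (u : Pt 2) (a b : Fin 2) : sff g φ ξ u a b =
    gip g (φ u) (covAlong g φ (fun q => dmap φ q b) a u) (ξ u) := rfl

lemma sff_sm (S : Setup g φ ξ lam U V) {u : Pt 2} (hu : u ∈ U) (a b : Fin 2) :
    SmAt (fun q => sff g φ ξ q a b) u := by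
  simp only [sff_eq]
  exact gip_sm (S.phi_sm u) (S.gsm _ (S.maps u hu))
    (covAlong_sm (S.phi_sm u) (S.gam_sm hu) (S.e_sm u b) a) (S.xi_sm u)

lemma lam_sm (S : Setup g φ ξ lam U V) {u : Pt 2} (hu : u ∈ U) : SmAt lam u := by
  have hG := fun a b => S.G_sm hu a b
  have hh := fun a b => S.sff_sm hu a b
  have h1 : SmAt (fun q => (sff g φ ξ q 0 0 * fff g φ q 1 1 + sff g φ ξ q 1 1 * fff g φ q 0 0
      - sff g φ ξ q 0 1 * fff g φ q 1 0 - sff g φ ξ q 1 0 * fff g φ q 0 1)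
      * (2 * (fff g φ q).det)⁻¹) u := by
    refine ContDiffAt.mul ?_ (ContDiffAt.inv (contDiffAt_const.mul (SmAt.det hG)) ?_)
    · exact ((((hh 0 0).mul (hG 1 1)).add ((hh 1 1).mul (hG 0 0))).sub
        ((hh 0 1).mul (hG 1 0))).sub ((hh 1 0).mul (hG 0 1))
    · exact mul_ne_zero two_ne_zero (S.Gdet u hu)
  refine h1.congr_of_eventuallyEq ?_
  filter_upwards [S.oU.mem_nhds hu] with q hq
  have := S.Gdet q hq
  simp only [S.umb]
  rw [eq_mul_inv_iff_mul_eq₀ (mul_ne_zero two_ne_zero this), Matrix.det_fin_two]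
  ring

lemma torsion (S : Setup g φ ξ lam U V) (u : Pt 2) (a b : Fin 2) :
    covAlong g φ (fun q => dmap φ q b) a u = covAlong g φ (fun q => dmap φ q a) b u := by
  ext k
  have hs : ∀ i j, christoffel g (φ u) k i j = christoffel g (φ u) k j i := fun i j =>
    chris_symm g _ (fun i j => Filter.Eventually.of_forall fun q => S.gsymm q i j) k i j
  simp only [covAlong]
  congr 1
  · exact pd_comm (S.phi_sm u k) a b
  · rw [Finset.sum_comm]
    refine Finset.sum_congr rfl fun i _ => Finset.sum_congr rfl fun j _ => ?_
    rw [hs]; ring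

lemma koszul (S : Setup g φ ξ lam U V) {u : Pt 2} (hu : u ∈ U) (a b d : Fin 2) :
    gip g (φ u) (covAlong g φ (fun q => dmap φ q b) a u) (dmap φ u d) = lowC (fff g φ) u d a b := by
  have hc : ∀ a b d, pd a (fun q => fff g φ q b d) u =
      gip g (φ u) (covAlong g φ (fun q => dmap φ q b) a u) (dmap φ u d) +
      gip g (φ u) (covAlong g φ (fun q => dmap φ q d) a u) (dmap φ u b) := by
    intro a b d
    rw [gip_symm S.gsymm _ _ (dmap φ u b)]
    exact compat S.gsymm (S.phi_sm u) (S.gsm _ (S.maps u hu)) (S.gdet _ (S.maps u hu))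
      (S.e_sm u b) (S.e_sm u d) a
  rw [lowC, hc, hc, hc, S.torsion u b a, S.torsion u d a, S.torsion u d b]
  ring

lemma gauss (S : Setup g φ ξ lam U V) {u : Pt 2} (hu : u ∈ U) (a b : Fin 2) :
    covAlong g φ (fun q => dmap φ q b) a u =
      christoffel (fff g φ) u 0 a b • dmap φ u 0 + christoffel (fff g φ) u 1 a b • dmap φ u 1
        + (lam u * fff g φ u a b) • ξ u := by
  rw [← sub_eq_zero]
  apply S.nondeg hu
  · intro d
    rw [gip_sub_left, S.koszul hu, ← lower (fff g φ) u (S.Gdet u hu)]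
    simp only [gip_add_left, gip_smul_left, Fin.sum_univ_two, S.nor.2.2]
    have hh : ∀ c, gip g (φ u) (dmap φ u c) (dmap φ u d) = fff g φ u d c := fun c =>
      gip_symm S.gsymm _ _ _
    rw [hh, hh]; ring
  · rw [gip_sub_left, ← sff_eq, S.umb]
    simp only [gip_add_left, gip_smul_left, S.nor.2.1]
    rw [gip_symm S.gsymm _ (dmap φ u 0) (ξ u), gip_symm S.gsymm _ (dmap φ u 1) (ξ u),
      S.nor.2.2, S.nor.2.2]
    ring

lemma weing (S : Setup g φ ξ lam U V) {u : Pt 2} (hu : u ∈ U) (a : Fin 2) :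
    covAlong g φ ξ a u = - (lam u • dmap φ u a) := by
  have hc := fun Y hY => compat (Y := Y) S.gsymm (S.phi_sm u) (S.gsm _ (S.maps u hu))
    (S.gdet _ (S.maps u hu)) (S.xi_sm u) hY a
  rw [← sub_eq_zero, sub_neg_eq_add]
  apply S.nondeg hu
  · intro b
    have h1 := hc (fun q => dmap φ q b) (S.e_sm u b)
    simp only [S.nor.2.2] at h1
    rw [gip_symm S.gsymm _ (ξ u), ← sff_eq, S.umb] at h1
    rw [gip_add_left, gip_smul_left]
    have h2 : pd a (fun _ : Pt 2 => (0 : ℝ)) u = 0 := by simp [pd]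
    have h3 : fff g φ u a b = gip g (φ u) (dmap φ u a) (dmap φ u b) := rfl
    rw [h2, h3] at h1
    linarith
  · have h1 := hc ξ (S.xi_sm u)
    simp only [S.nor.2.1] at h1
    have h2 : pd a (fun _ : Pt 2 => (1 : ℝ)) u = 0 := by simp [pd]
    rw [gip_symm S.gsymm _ (ξ u), h2] at h1
    rw [gip_add_left, gip_smul_left, gip_symm S.gsymm _ (dmap φ u a), S.nor.2.2]
    linarith

lemma inv_symm (S : Setup g φ ξ lam U V) (u : Pt 2) (a b : Fin 2) :
    (fff g φ u)⁻¹ a b = (fff g φ u)⁻¹ b a := by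
  have h : (fff g φ u).transpose = fff g φ u := by
    ext i j; exact S.G_symm u j i
  conv_lhs => rw [← h, ← Matrix.transpose_nonsing_inv]
  rfl

lemma inv_mul (S : Setup g φ ξ lam U V) {u : Pt 2} (hu : u ∈ U) (a c : Fin 2) :
    (fff g φ u)⁻¹ a 0 * fff g φ u 0 c + (fff g φ u)⁻¹ a 1 * fff g φ u 1 c = if a = c then 1 else 0 := by
  have h := Matrix.nonsing_inv_mul (fff g φ u) (isUnit_iff_ne_zero.mpr (S.Gdet u hu))
  have := congrFun (congrFun h a) c
  rw [Matrix.mul_apply, Fin.sum_univ_two, Matrix.one_apply] at this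
  exact this

lemma trace_inv (S : Setup g φ ξ lam U V) {u : Pt 2} (hu : u ∈ U) :
    (fff g φ u)⁻¹ 0 0 * fff g φ u 0 0 + (fff g φ u)⁻¹ 0 1 * fff g φ u 0 1 +
    ((fff g φ u)⁻¹ 1 0 * fff g φ u 1 0 + (fff g φ u)⁻¹ 1 1 * fff g φ u 1 1) = 2 := by
  have h0 := S.inv_mul hu 0 0
  have h1 := S.inv_mul hu 1 1
  simp only [if_true] at h0 h1
  have e1 := S.G_symm u 0 1
  rw [e1] at *
  rw [S.G_symm u 0 1] at h1
  linarith

lemma mean (S : Setup g φ ξ lam U V) {u : Pt 2} (hu : u ∈ U) : meanCurv g φ ξ u = lam u := by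
  have h := S.trace_inv hu
  simp only [meanCurv, shapeOp, Fin.sum_univ_two, S.umb]
  rw [S.G_symm u 0 1] at h
  rw [S.G_symm u 0 1]
  push_cast
  linear_combination (lam u / 2) * h

lemma tens (S : Setup g φ ξ lam U V) {u : Pt 2} (hu : u ∈ U) : tension g φ u = (2 * lam u) • ξ u := by
  ext k
  have hg : ∀ a b, fderiv ℝ (fun q => dmap φ q b k) u (Pi.single a 1)
      - ∑ c, christoffel (fff g φ) u c a b * dmap φ u c k
      + ∑ i, ∑ j, christoffel g (φ u) k i j * dmap φ u a i * dmap φ u b j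
      = lam u * fff g φ u a b * ξ u k := by
    intro a b
    have h := congrFun (S.gauss hu a b) k
    have h2 : covAlong g φ (fun q => dmap φ q b) a u k =
      fderiv ℝ (fun q => dmap φ q b k) u (Pi.single a 1) +
      ∑ i, ∑ j, christoffel g (φ u) k i j * dmap φ u a i * dmap φ u b j := rfl
    simp only [Pi.add_apply, Pi.smul_apply, smul_eq_mul] at h
    rw [Fin.sum_univ_two]
    rw [h2] at h
    linarith
  simp only [tension, hg]
  have h := S.trace_inv hu
  simp only [Fin.sum_univ_two, Pi.smul_apply, smul_eq_mul]
  linear_combination (lam u * ξ u k) * h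

end Setup

lemma cov_smul {g : Met 3} {φ X : Pt 2 → Pt 3} {f : Pt 2 → ℝ} {u : Pt 2} (hf : SmAt f u)
    (hX : ∀ k, SmAt (fun q => X q k) u) (a : Fin 2) :
    covAlong g φ (fun q => f q • X q) a u = pd a f u • X u + f u • covAlong g φ X a u := by
  ext k
  simp only [covAlong, Pi.add_apply, Pi.smul_apply, smul_eq_mul]
  rw [show fderiv ℝ (fun q => f q * X q k) u (Pi.single a 1) = _ from pd_mul hf (hX k) a]
  simp only [Fin.sum_univ_three]
  ring

lemma cov_add {g : Met 3} {φ X Y : Pt 2 → Pt 3} {u : Pt 2} (hX : ∀ k, SmAt (fun q => X q k) u)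
    (hY : ∀ k, SmAt (fun q => Y q k) u) (a : Fin 2) :
    covAlong g φ (fun q => X q + Y q) a u = covAlong g φ X a u + covAlong g φ Y a u := by
  ext k
  simp only [covAlong, Pi.add_apply]
  rw [show fderiv ℝ (fun q => X q k + Y q k) u (Pi.single a 1) = _ from pd_add (hX k) (hY k) a]
  simp only [Fin.sum_univ_three]
  ring

lemma cov_congr {g : Met 3} {φ X Y : Pt 2 → Pt 3} {u : Pt 2} {U : Set (Pt 2)} (hU : IsOpen U)
    (hu : u ∈ U) (h : ∀ q ∈ U, X q = Y q) (a : Fin 2) :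
    covAlong g φ X a u = covAlong g φ Y a u := by
  ext k
  simp only [covAlong]
  rw [show fderiv ℝ (fun q => X q k) u (Pi.single a 1) = _ from
    pd_congr hU hu (fun q hq => congrFun (h q hq) k) a, h u hu]

namespace Setup
variable {g : Met 3} {φ ξ : Pt 2 → Pt 3} {lam : Pt 2 → ℝ} {U : Set (Pt 2)} {V : Set (Pt 3)}

lemma cov_tens (S : Setup g φ ξ lam U V) {u : Pt 2} (hu : u ∈ U) (b : Fin 2) :
    covAlong g φ (tension g φ) b u = (2 * pd b lam u) • ξ u + (-2 * lam u ^ 2) • dmap φ u b := by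
  rw [cov_congr S.oU hu (fun q hq => S.tens hq) b]
  have hl := S.lam_sm hu
  rw [cov_smul (f := fun q => 2 * lam q) (contDiffAt_const.mul hl) (S.xi_sm u), S.weing hu,
    pd_mul contDiffAt_const hl]
  ext k
  simp [pd]
  ring

lemma cov_cov_tens (S : Setup g φ ξ lam U V) {u : Pt 2} (hu : u ∈ U) (a b : Fin 2) :
    covAlong g φ (covAlong g φ (tension g φ) b) a u =
      (2 * pd a (fun q => pd b lam q) u - 2 * lam u ^ 3 * fff g φ u a b) • ξ u
      - (2 * lam u * pd b lam u) • dmap φ u a - (4 * lam u * pd a lam u) • dmap φ u b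
      - (2 * lam u ^ 2) • (christoffel (fff g φ) u 0 a b • dmap φ u 0
        + christoffel (fff g φ) u 1 a b • dmap φ u 1) := by
  rw [cov_congr S.oU hu (fun q hq => S.cov_tens hq b) a]
  have hl := S.lam_sm hu
  have h1 : SmAt (fun q => 2 * pd b lam q) u := contDiffAt_const.mul (hl.fd _)
  have h2 : SmAt (fun q => -2 * lam q ^ 2) u := contDiffAt_const.mul (hl.pow 2)
  have p1 : pd a (fun q => 2 * pd b lam q) u = 2 * pd a (fun q => pd b lam q) u := by
    rw [pd_mul contDiffAt_const (hl.fd _)]; simp [pd]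
  have p2 : pd a (fun q => -2 * lam q ^ 2) u = -4 * lam u * pd a lam u := by
    have : (fun q => -2 * lam q ^ 2) = fun q => -2 * lam q * lam q := by ext q; ring
    rw [this, pd_mul3 contDiffAt_const hl hl]; simp [pd]; ring
  rw [cov_add (X := fun q => (2 * pd b lam q) • ξ q) (Y := fun q => (-2 * lam q ^ 2) • dmap φ q b)
    (fun k => h1.mul (S.xi_sm u k)) (fun k => h2.mul (S.e_sm u b k)),
    cov_smul h1 (S.xi_sm u), cov_smul h2 (S.e_sm u b), S.weing hu, S.gauss hu, p1, p2]
  ext k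
  simp only [Pi.add_apply, Pi.sub_apply, Pi.smul_apply, Pi.neg_apply, smul_eq_mul]
  ring

end Setup

/-- the vertical field -/
def Ez : Pt 3 := Pi.single 2 1

/-- curvature of the model -/
def CurvForm (g : Met 3) (V : Set (Pt 3)) (a b : ℝ) : Prop :=
  (∀ p ∈ V, gip g p Ez Ez = 1) ∧ ∀ p ∈ V, ∀ v w z : Pt 3, curvPt g p v w z =
    a • (gip g p w z • v - gip g p v z • w)
    + b • ((gip g p w Ez * gip g p z Ez) • v - (gip g p v Ez * gip g p z Ez) • w
      + (gip g p w z * gip g p v Ez - gip g p v z * gip g p w Ez) • Ez)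

/-- Laplacian of lam -/
def lap (g : Met 3) (φ : Pt 2 → Pt 3) (lam : Pt 2 → ℝ) (u : Pt 2) : ℝ :=
  ∑ a, ∑ b, (fff g φ u)⁻¹ a b * (pd a (fun q => pd b lam q) u
    - ∑ c, christoffel (fff g φ) u c a b * pd c lam u)

namespace Setup
variable {g : Met 3} {φ ξ : Pt 2 → Pt 3} {lam : Pt 2 → ℝ} {U : Set (Pt 2)} {V : Set (Pt 3)}
  {a b : ℝ}

lemma codazzi0 (S : Setup g φ ξ lam U V) (hR : CurvForm g V a b) {u : Pt 2} (hu : u ∈ U) :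
    (pd 1 lam u - b * gip g (φ u) (ξ u) Ez * gip g (φ u) (dmap φ u 1) Ez) • dmap φ u 0
    - (pd 0 lam u - b * gip g (φ u) (ξ u) Ez * gip g (φ u) (dmap φ u 0) Ez) • dmap φ u 1 = 0 := by
  have h := curvComm (S.phi_sm u) (S.gam_sm hu) (S.xi_sm u) 0 1
  rw [hR.2 _ (S.maps u hu), gip_symm S.gsymm _ (dmap φ u 0) (ξ u),
    gip_symm S.gsymm _ (dmap φ u 1) (ξ u), S.nor.2.2, S.nor.2.2] at h
  have hl := S.lam_sm hu
  have hn : SmAt (fun q => - lam q) u := hl.neg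
  have hp : ∀ c, pd c (fun q => - lam q) u = - pd c lam u := by
    intro c; simp [pd]
  have hw : ∀ c d, covAlong g φ (covAlong g φ ξ d) c u = (- pd c lam u) • dmap φ u d +
      (- lam u) • covAlong g φ (fun q => dmap φ q d) c u := by
    intro c d
    rw [cov_congr (Y := fun q => (- lam q) • dmap φ q d) S.oU hu
      (fun q hq => by rw [S.weing hq d, neg_smul]) c, cov_smul hn (S.e_sm u d), hp]
  rw [hw, hw, S.torsion u 1 0] at h
  ext k
  have hk := congrFun h k
  simp only [Pi.add_apply, Pi.sub_apply, Pi.smul_apply, smul_eq_mul, Pi.zero_apply] at hk ⊢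
  linarith

lemma codazzi (S : Setup g φ ξ lam U V) (hR : CurvForm g V a b) {u : Pt 2} (hu : u ∈ U)
    (c : Fin 2) :
    pd c lam u = b * gip g (φ u) (ξ u) Ez * gip g (φ u) (dmap φ u c) Ez := by
  have h := S.codazzi0 hR hu
  have hli := S.imm.2 u
  rw [Fintype.linearIndependent_iff] at hli
  have h2 := hli ![pd 1 lam u - b * gip g (φ u) (ξ u) Ez * gip g (φ u) (dmap φ u 1) Ez,
    -(pd 0 lam u - b * gip g (φ u) (ξ u) Ez * gip g (φ u) (dmap φ u 0) Ez)] (by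
      rw [Fin.sum_univ_two]
      simp only [Matrix.cons_val_zero, Matrix.cons_val_one, neg_smul]
      rw [← sub_eq_add_neg]
      exact h)
  have h3 := h2 0
  have h4 := h2 1
  simp only [Matrix.cons_val_zero, Matrix.cons_val_one] at h3 h4
  fin_cases c
  · simp only [Fin.zero_eta, Fin.isValue]
    linarith
  · simp only [Fin.mk_one, Fin.isValue]
    linarith

lemma split (S : Setup g φ ξ lam U V) {u : Pt 2} (hu : u ∈ U) :
    Ez = ∑ c, ((fff g φ u)⁻¹ c 0 * gip g (φ u) (dmap φ u 0) Ez
      + (fff g φ u)⁻¹ c 1 * gip g (φ u) (dmap φ u 1) Ez) • dmap φ u c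
      + gip g (φ u) (ξ u) Ez • ξ u := by
  rw [← sub_eq_zero, Fin.sum_univ_two]
  have i00 := S.inv_mul hu 0 0
  have i01 := S.inv_mul hu 0 1
  have i10 := S.inv_mul hu 1 0
  have i11 := S.inv_mul hu 1 1
  have is := S.inv_symm u 0 1
  simp only [if_true] at i00 i11
  rw [if_neg (by decide)] at i01 i10
  have hG : ∀ a b, gip g (φ u) (dmap φ u a) (dmap φ u b) = fff g φ u a b := fun a b => rfl
  have hs := S.G_symm u 0 1
  apply S.nondeg hu
  · intro d
    simp only [gip_sub_left, gip_add_left, gip_smul_left, S.nor.2.2, hG]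
    rw [gip_symm S.gsymm _ Ez]
    fin_cases d
    · simp only [Fin.zero_eta, Fin.isValue]
      linear_combination (-gip g (φ u) (dmap φ u 0) Ez) * i00
       - (gip g (φ u) (dmap φ u 1) Ez) * i10 + gip g (φ u) (dmap φ u 0) Ez * fff g φ u 1 0 * is
       - gip g (φ u) (dmap φ u 1) Ez * fff g φ u 0 0 * is
    · simp only [Fin.mk_one, Fin.isValue]
      linear_combination (-gip g (φ u) (dmap φ u 0) Ez) * i01
       - (gip g (φ u) (dmap φ u 1) Ez) * i11 + gip g (φ u) (dmap φ u 0) Ez * fff g φ u 1 1 * is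
       - gip g (φ u) (dmap φ u 1) Ez * fff g φ u 0 1 * is
  · simp only [gip_sub_left, gip_add_left, gip_smul_left, S.nor.2.1]
    rw [gip_symm S.gsymm _ Ez, gip_symm S.gsymm _ (dmap φ u 0) (ξ u),
      gip_symm S.gsymm _ (dmap φ u 1) (ξ u), S.nor.2.2, S.nor.2.2]
    ring

lemma bit (S : Setup g φ ξ lam U V) (hR : CurvForm g V a b) {u : Pt 2} (hu : u ∈ U) :
    bitension g φ u =
      (2 * lap g φ lam u - 4 * lam u ^ 3
        + 2 * lam u * (2 * a + b * (1 + gip g (φ u) (ξ u) Ez ^ 2))) • ξ u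
      - (4 * lam u) • ∑ c, ((fff g φ u)⁻¹ c 0 * pd 0 lam u
          + (fff g φ u)⁻¹ c 1 * pd 1 lam u) • dmap φ u c := by
  have hE := S.split hu
  have hEE := hR.1 _ (S.maps u hu)
  have hc0 := S.codazzi hR hu 0
  have hc1 := S.codazzi hR hu 1
  have htr := S.trace_inv hu
  have is := S.inv_symm u 0 1
  have hG : ∀ a b, gip g (φ u) (dmap φ u a) (dmap φ u b) = fff g φ u a b := fun a b => rfl
  have hEE2 : 1 = (((fff g φ u)⁻¹ 0 0 * gip g (φ u) (dmap φ u 0) Ez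
      + (fff g φ u)⁻¹ 0 1 * gip g (φ u) (dmap φ u 1) Ez) * gip g (φ u) (dmap φ u 0) Ez
      + ((fff g φ u)⁻¹ 1 0 * gip g (φ u) (dmap φ u 0) Ez
      + (fff g φ u)⁻¹ 1 1 * gip g (φ u) (dmap φ u 1) Ez) * gip g (φ u) (dmap φ u 1) Ez)
      + gip g (φ u) (ξ u) Ez * gip g (φ u) (ξ u) Ez := by
    have := congrArg (fun W => gip g (φ u) W Ez) hE
    simp only [Fin.sum_univ_two, gip_add_left, gip_smul_left, hEE] at this
    exact this
  ext k
  have hEk := congrFun hE k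
  simp only [bitension, lap, S.cov_cov_tens hu, S.cov_tens hu, S.tens hu,
    hR.2 _ (S.maps u hu), gip_smul_left, S.nor.2.2, hG, Fin.sum_univ_two, Pi.add_apply,
    Pi.sub_apply, Pi.smul_apply, smul_eq_mul] at hEk ⊢
  simp only [hc0, hc1, is] at *
  generalize pd 0 (fun q => pd 0 lam q) u = l00
  generalize pd 0 (fun q => pd 1 lam q) u = l01
  generalize pd 1 (fun q => pd 0 lam q) u = l10
  generalize pd 1 (fun q => pd 1 lam q) u = l11
  generalize gip g (φ u) (ξ u) Ez = ν at *
  generalize gip g (φ u) (dmap φ u 0) Ez = η0 at *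
  generalize gip g (φ u) (dmap φ u 1) Ez = η1 at *
  generalize (fff g φ u)⁻¹ 0 0 = i00 at *
  generalize (fff g φ u)⁻¹ 1 0 = i10 at *
  generalize (fff g φ u)⁻¹ 1 1 = i11 at *
  generalize fff g φ u 0 0 = G00 at *
  generalize fff g φ u 0 1 = G01 at *
  generalize fff g φ u 1 0 = G10 at *
  generalize fff g φ u 1 1 = G11 at *
  generalize dmap φ u 0 k = e0 at *
  generalize dmap φ u 1 k = e1 at *
  generalize ξ u k = x at *
  generalize Ez k = ez at *
  generalize lam u = L at *
  linear_combination (-2 * L ^ 3 * x + 2 * L * a * x + 2 * L * b * ν * ez) * htr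
    - 2 * L * b * x * hEE2 + 4 * L * b * ν * hEk
end Setup

namespace Setup
variable {g : Met 3} {φ ξ : Pt 2 → Pt 3} {lam : Pt 2 → ℝ} {U : Set (Pt 2)} {V : Set (Pt 3)}
  {a b : ℝ}

lemma gip_EE (S : Setup g φ ξ lam U V) (hR : CurvForm g V a b) {u : Pt 2} (hu : u ∈ U) :
    1 = (((fff g φ u)⁻¹ 0 0 * gip g (φ u) (dmap φ u 0) Ez
      + (fff g φ u)⁻¹ 0 1 * gip g (φ u) (dmap φ u 1) Ez) * gip g (φ u) (dmap φ u 0) Ez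
      + ((fff g φ u)⁻¹ 1 0 * gip g (φ u) (dmap φ u 0) Ez
      + (fff g φ u)⁻¹ 1 1 * gip g (φ u) (dmap φ u 1) Ez) * gip g (φ u) (dmap φ u 1) Ez)
      + gip g (φ u) (ξ u) Ez * gip g (φ u) (ξ u) Ez := by
  have := congrArg (fun W => gip g (φ u) W Ez) (S.split hu)
  simp only [Fin.sum_univ_two, gip_add_left, gip_smul_left, hR.1 _ (S.maps u hu)] at this
  exact this

lemma lap_zero {u : Pt 2} (h : ∀ᶠ q in nhds u, ∀ c, pd c lam q = 0) : lap g φ lam u = 0 := by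
  have h1 : ∀ c, pd c lam u = 0 := h.self_of_nhds
  have h2 : ∀ c d, pd d (fun q => pd c lam q) u = 0 := by
    intro c d
    have : (fun q => pd c lam q) =ᶠ[nhds u] fun _ => 0 := by
      filter_upwards [h] with q hq using hq c
    have h3 := this.fderiv_eq (𝕜 := ℝ)
    simp only [pd] at h3 ⊢
    rw [h3]
    simp
  simp only [lap, h1, h2]
  simp

lemma near (S : Setup g φ ξ lam U V) {u : Pt 2} (hu : u ∈ U) (hl : lam u ≠ 0) :
    ∀ᶠ q in nhds u, q ∈ U ∧ lam q ≠ 0 := by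
  have h1 := (S.lam_sm hu).continuousAt.eventually_ne hl
  filter_upwards [h1, S.oU.mem_nhds hu] with q h2 h3 using ⟨h3, h2⟩

lemma fwd1 (S : Setup g φ ξ lam U V) (hR : CurvForm g V a b) (hB : IsBiharmonic g φ)
    {u : Pt 2} (hu : u ∈ U) (hl : lam u ≠ 0) (d : Fin 2) : pd d lam u = 0 := by
  have h := S.bit hR hu
  rw [hB u] at h
  have i00 := S.inv_mul hu 0 0
  have i01 := S.inv_mul hu 0 1
  have i10 := S.inv_mul hu 1 0
  have i11 := S.inv_mul hu 1 1
  have is := S.inv_symm u 0 1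
  simp only [if_true] at i00 i11
  rw [if_neg (by decide)] at i01 i10
  have hG : ∀ a b, gip g (φ u) (dmap φ u a) (dmap φ u b) = fff g φ u a b := fun a b => rfl
  have h2 := congrArg (fun W => gip g (φ u) W (dmap φ u d)) h
  have h0 : gip g (φ u) 0 (dmap φ u d) = 0 := by simp [gip]
  simp only [Fin.sum_univ_two, gip_sub_left, gip_add_left, gip_smul_left, S.nor.2.2, hG, h0] at h2
  have h3 : lam u * pd d lam u = 0 := by
    fin_cases d
    · simp only [Fin.zero_eta, Fin.isValue] at h2 ⊢
      linear_combination (1/4) * h2 - lam u * pd 0 lam u * i00 - lam u * pd 1 lam u * i10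
        + lam u * (pd 0 lam u * fff g φ u 1 0 - pd 1 lam u * fff g φ u 0 0) * is
    · simp only [Fin.mk_one, Fin.isValue] at h2 ⊢
      linear_combination (1/4) * h2 - lam u * pd 0 lam u * i01 - lam u * pd 1 lam u * i11
        + lam u * (pd 0 lam u * fff g φ u 1 1 - pd 1 lam u * fff g φ u 0 1) * is
  exact (mul_eq_zero.mp h3).resolve_left hl

lemma fwd2 (S : Setup g φ ξ lam U V) (hR : CurvForm g V a b) (hB : IsBiharmonic g φ)
    {u : Pt 2} (hu : u ∈ U) (hl : lam u ≠ 0) :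
    2 * lam u ^ 2 = 2 * a + b * (1 + gip g (φ u) (ξ u) Ez ^ 2) := by
  have h := S.bit hR hu
  have hz : lap g φ lam u = 0 := by
    apply lap_zero
    filter_upwards [S.near hu hl] with q hq c using S.fwd1 hR hB hq.1 hq.2 c
  simp only [hB u, hz, S.fwd1 hR hB hu hl] at h
  have h2 := congrArg (fun W => gip g (φ u) W (ξ u)) h
  have h0 : gip g (φ u) 0 (ξ u) = 0 := by simp [gip]
  simp only [mul_zero, add_zero, zero_smul, Finset.sum_const_zero, smul_zero, sub_zero,
    gip_smul_left, S.nor.2.1, h0] at h2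
  have h3 : lam u * (2 * lam u ^ 2 - (2 * a + b * (1 + gip g (φ u) (ξ u) Ez ^ 2))) = 0 := by
    linarith
  linarith [(mul_eq_zero.mp h3).resolve_left hl]

lemma fwd3 (S : Setup g φ ξ lam U V) (hR : CurvForm g V a b) (hB : IsBiharmonic g φ) (hb : b ≠ 0)
    {u : Pt 2} (hu : u ∈ U) (hl : lam u ≠ 0) :
    (gip g (φ u) (ξ u) Ez = 0 ∧ 2 * lam u ^ 2 = 2 * a + b) ∨
    ((∀ c, gip g (φ u) (dmap φ u c) Ez = 0) ∧ gip g (φ u) (ξ u) Ez ^ 2 = 1 ∧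
      lam u ^ 2 = a + b) := by
  have h2 := S.fwd2 hR hB hu hl
  have hE := S.gip_EE hR hu
  have hc := S.codazzi hR hu
  by_cases hν : gip g (φ u) (ξ u) Ez = 0
  · left
    refine ⟨hν, ?_⟩
    rw [hν] at h2; linarith
  · right
    have hη : ∀ c, gip g (φ u) (dmap φ u c) Ez = 0 := by
      intro c
      have := hc c
      rw [S.fwd1 hR hB hu hl] at this
      exact (mul_eq_zero.mp this.symm).resolve_left (mul_ne_zero hb hν)
    rw [hη, hη] at hE
    have h1 : gip g (φ u) (ξ u) Ez ^ 2 = 1 := by rw [hE]; ring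
    refine ⟨hη, h1, ?_⟩
    rw [h1] at h2; linarith

lemma cov_Ez (u : Pt 2) (c : Fin 2) :
    covAlong g φ (fun _ => Ez) c u = GamV g (φ u) (dmap φ u c) Ez := by
  ext k; simp [covAlong, GamV]

/-- nonintegrable case -/
lemma killing (S : Setup g φ ξ lam U V) (hR : CurvForm g V a b) (hB : IsBiharmonic g φ) (hb : b ≠ 0)
    (hab : 2 * a + b ≤ 0)
    (hK : ∀ p ∈ V, ∀ v w, gip g p v (GamV g p w Ez) + gip g p w (GamV g p v Ez) = 0)
    {u : Pt 2} (hu : u ∈ U) : lam u = 0 := by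
  by_contra hl
  have h3 : ∀ q ∈ U, lam q ≠ 0 → (∀ c, gip g (φ q) (dmap φ q c) Ez = 0) ∧
      gip g (φ q) (ξ q) Ez ^ 2 = 1 := by
    intro q hq hlq
    rcases S.fwd3 hR hB hb hq hlq with h | h
    · have : 0 < lam q ^ 2 := by positivity
      linarith [h.2]
    · exact ⟨h.1, h.2.1⟩
  have hd : ∀ c d, pd d (fun q => gip g (φ q) (dmap φ q c) Ez) u = 0 := by
    intro c d
    have : (fun q => gip g (φ q) (dmap φ q c) Ez) =ᶠ[nhds u] fun _ => 0 := by
      filter_upwards [S.near hu hl] with q hq using (h3 q hq.1 hq.2).1 c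
    simp only [pd]
    rw [this.fderiv_eq]
    simp
  have hcomp : ∀ c d, 0 = lam u * fff g φ u d c * gip g (φ u) (ξ u) Ez +
      gip g (φ u) (dmap φ u c) (GamV g (φ u) (dmap φ u d) Ez) := by
    intro c d
    have := compat (Y := fun _ => Ez) S.gsymm (S.phi_sm u) (S.gsm _ (S.maps u hu))
      (S.gdet _ (S.maps u hu)) (S.e_sm u c) (fun k => contDiffAt_const) d
    rw [hd, S.gauss hu, cov_Ez] at this
    simp only [gip_add_left, gip_smul_left, (h3 u hu hl).1] at this
    linarith
  have hν : gip g (φ u) (ξ u) Ez ≠ 0 := by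
    intro h0
    have := (h3 u hu hl).2
    rw [h0] at this; norm_num at this
  have hG : ∀ c d, fff g φ u c d = 0 := by
    intro c d
    have h1 := hcomp c d
    have h2 := hcomp d c
    have h4 := hK _ (S.maps u hu) (dmap φ u c) (dmap φ u d)
    rw [S.G_symm u d c] at h1
    have h5 : (lam u * gip g (φ u) (ξ u) Ez) * fff g φ u c d = 0 := by linarith
    exact (mul_eq_zero.mp h5).resolve_left (mul_ne_zero hl hν)
  apply S.Gdet u hu
  rw [Matrix.det_fin_two]
  simp [hG]

/-- parallel case -/
lemma parallel (S : Setup g φ ξ lam U V) (hR : CurvForm g V a b) (hB : IsBiharmonic g φ)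
    (hb : b ≠ 0) (hab : a + b ≤ 0)
    (hK : ∀ p ∈ V, ∀ v w, gip g p v (GamV g p w Ez) = 0)
    {u : Pt 2} (hu : u ∈ U) : lam u = 0 := by
  by_contra hl
  have h3 : ∀ q ∈ U, lam q ≠ 0 → gip g (φ q) (ξ q) Ez = 0 := by
    intro q hq hlq
    rcases S.fwd3 hR hB hb hq hlq with h | h
    · exact h.1
    · have : 0 < lam q ^ 2 := by positivity
      linarith [h.2.2]
  have hd : ∀ d, pd d (fun q => gip g (φ q) (ξ q) Ez) u = 0 := by
    intro d
    have : (fun q => gip g (φ q) (ξ q) Ez) =ᶠ[nhds u] fun _ => 0 := by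
      filter_upwards [S.near hu hl] with q hq using (h3 q hq.1 hq.2)
    simp only [pd]
    rw [this.fderiv_eq]
    simp
  have hη : ∀ d, gip g (φ u) (dmap φ u d) Ez = 0 := by
    intro d
    have := compat (Y := fun _ => Ez) S.gsymm (S.phi_sm u) (S.gsm _ (S.maps u hu))
      (S.gdet _ (S.maps u hu)) (S.xi_sm u) (fun k => contDiffAt_const) d
    rw [hd, S.weing hu, cov_Ez, hK _ (S.maps u hu), gip_neg_left, gip_smul_left] at this
    have h5 : lam u * gip g (φ u) (dmap φ u d) Ez = 0 := by linarith
    exact (mul_eq_zero.mp h5).resolve_left hl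
  have hE := S.gip_EE hR hu
  rw [hη, hη, h3 u hu hl] at hE
  norm_num at hE

end Setup

lemma mkSetup {g : Met 3} {φ ξ : Pt 2 → Pt 3} {lam : Pt 2 → ℝ} {V : Set (Pt 3)} (oV : IsOpen V)
    (gsm : ∀ p ∈ V, ∀ i j, SmAt (fun q => g q i j) p)
    (gsymm : ∀ p i j, g p i j = g p j i) (gdet : ∀ p ∈ V, (g p).det ≠ 0)
    (imm : IsImmersion φ) (nor : IsUnitNormal g φ ξ)
    (umb : ∀ u a b, sff g φ ξ u a b = lam u * fff g φ u a b) :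
    Setup g φ ξ lam {u | φ u ∈ V ∧ (fff g φ u).det ≠ 0} V := by
  refine ⟨?_, oV, fun u hu => hu.1, gsm, gsymm, gdet, imm, nor, umb, fun u hu => hu.2⟩
  rw [isOpen_iff_mem_nhds]
  intro u hu
  have hs : ∀ k, SmAt (fun q => φ q k) u := fun k => (imm.1 k).contDiffAt
  have hc : ContinuousAt φ u := continuousAt_pi.mpr fun k => (hs k).continuousAt
  have h1 : ∀ᶠ q in nhds u, φ q ∈ V := hc.eventually (oV.mem_nhds hu.1)
  have h2 : SmAt (fun q => (fff g φ q).det) u := SmAt.det fun a b =>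
    gip_sm hs (gsm _ hu.1) (fun k => (hs k).fd _) (fun k => (hs k).fd _)
  have h3 := h2.continuousAt.eventually_ne hu.2
  filter_upwards [h1, h3] with q ha hb using ⟨ha, hb⟩

lemma tension_zero {g : Met 3} {φ : Pt 2 → Pt 3} {u : Pt 2} (h : (fff g φ u).det = 0) :
    tension g φ u = 0 := by
  have : (fff g φ u)⁻¹ = 0 := Matrix.nonsing_inv_apply_not_isUnit _ (by simp [h])
  ext k
  simp [tension, this]

/-- reduction: all models -/
lemma no_proper {g : Met 3} {φ ξ : Pt 2 → Pt 3} {lam : Pt 2 → ℝ} {V : Set (Pt 3)} (oV : IsOpen V)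
    (gsm : ∀ p ∈ V, ∀ i j, SmAt (fun q => g q i j) p)
    (gsymm : ∀ p i j, g p i j = g p j i) (gdet : ∀ p ∈ V, (g p).det ≠ 0)
    (imm : IsImmersion φ) (nor : IsUnitNormal g φ ξ)
    (umb : ∀ u a b, sff g φ ξ u a b = lam u * fff g φ u a b)
    (hV : ∀ u, φ u ∉ V → (fff g φ u).det = 0)
    (hl : ∀ U, Setup g φ ξ lam U V → ∀ u ∈ U, lam u = 0) : IsMinimal g φ := by
  intro u
  by_cases hd : (fff g φ u).det = 0
  · exact tension_zero hd
  · have hv : φ u ∈ V := by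
      by_contra h; exact hd (hV u h)
    have S := mkSetup oV gsm gsymm gdet imm nor umb
    have hu : u ∈ {u | φ u ∈ V ∧ (fff g φ u).det ≠ 0} := ⟨hv, hd⟩
    rw [S.tens hu, hl _ S u hu]
    simp

lemma chris_of_low {g : Met 3} {p : Pt 3} (hd : (g p).det ≠ 0) {i j : Fin 3} {C : Fin 3 → ℝ}
    (h : ∀ l, ∑ k, g p l k * C k = lowC g p l i j) (k : Fin 3) : christoffel g p k i j = C k := by
  have h1 : (g p).mulVec (fun k => christoffel g p k i j - C k) = 0 := by
    ext l
    have e1 := lower g p hd l i j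
    have e2 := h l
    simp only [Matrix.mulVec, dotProduct, mul_sub, Finset.sum_sub_distrib, Pi.zero_apply]
    linarith
  have := congrFun (Matrix.eq_zero_of_mulVec_eq_zero hd h1) k
  simp only [Pi.zero_apply] at this
  linarith

lemma curvForm_of {g : Met 3} {V : Set (Pt 3)} (oV : IsOpen V)
    (gsm : ∀ p ∈ V, ∀ i j, SmAt (fun q => g q i j) p)
    (gsymm : ∀ p i j, g p i j = g p j i) (gdet : ∀ p ∈ V, (g p).det ≠ 0)
    (g22 : ∀ p ∈ V, g p 2 2 = 1) (a b : ℝ)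
    (C : Fin 3 → Fin 3 → Fin 3 → Pt 3 → ℝ)
    (hC : ∀ p ∈ V, ∀ k i j, christoffel g p k i j = C k i j p)
    (hR : ∀ p ∈ V, ∀ k i j l, pd i (C k j l) p - pd j (C k i l) p
      + (C k i 0 p * C 0 j l p + C k i 1 p * C 1 j l p + C k i 2 p * C 2 j l p)
      - (C k j 0 p * C 0 i l p + C k j 1 p * C 1 i l p + C k j 2 p * C 2 i l p)
      = a * (g p j l * (if k = i then 1 else 0) - g p i l * (if k = j then 1 else 0))
       + b * (g p j 2 * g p l 2 * (if k = i then 1 else 0)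
          - g p i 2 * g p l 2 * (if k = j then 1 else 0)
          + (g p j l * g p i 2 - g p i l * g p j 2) * (if k = 2 then 1 else 0))) :
    CurvForm g V a b := by
  have hz : ∀ p v, gip g p v Ez = g p 0 2 * v 0 + g p 1 2 * v 1 + g p 2 2 * v 2 := by
    intro p v
    simp [gip, Ez, Fin.sum_univ_three]
  refine ⟨?_, ?_⟩
  · intro p hp
    rw [hz]; simp [Ez, g22 p hp]
  · intro p hp v w z
    ext k
    rw [curvPt_eq (chris_smooth g p (gsm p hp) (gdet p hp))]
    have hf : ∀ k i j v, fderiv ℝ (fun q => christoffel g q k i j) p v =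
        v 0 * pd 0 (C k i j) p + v 1 * pd 1 (C k i j) p + v 2 * pd 2 (C k i j) p := by
      intro k i j v
      have : (fun q => christoffel g q k i j) =ᶠ[nhds p] C k i j := by
        filter_upwards [oV.mem_nhds hp] with q hq using hC q hq k i j
      rw [this.fderiv_eq, fd_expand]
    have hk : ∀ i j l, v i * w j * z l * (pd i (C k j l) p - pd j (C k i l) p
      + (C k i 0 p * C 0 j l p + C k i 1 p * C 1 j l p + C k i 2 p * C 2 j l p)
      - (C k j 0 p * C 0 i l p + C k j 1 p * C 1 i l p + C k j 2 p * C 2 i l p)) = 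
      v i * w j * z l * (a * (g p j l * (if k = i then 1 else 0) - g p i l * (if k = j then 1 else 0))
       + b * (g p j 2 * g p l 2 * (if k = i then 1 else 0)
          - g p i 2 * g p l 2 * (if k = j then 1 else 0)
          + (g p j l * g p i 2 - g p i l * g p j 2) * (if k = 2 then 1 else 0))) := 
      fun i j l => by rw [hR p hp k i j l]
    have hsum : ∑ i, ∑ j, ∑ l, v i * w j * z l * (pd i (C k j l) p - pd j (C k i l) p
      + (C k i 0 p * C 0 j l p + C k i 1 p * C 1 j l p + C k i 2 p * C 2 j l p)
      - (C k j 0 p * C 0 i l p + C k j 1 p * C 1 i l p + C k j 2 p * C 2 i l p)) = 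
      ∑ i, ∑ j, ∑ l, v i * w j * z l * (a * (g p j l * (if k = i then 1 else 0) - g p i l * (if k = j then 1 else 0))
       + b * (g p j 2 * g p l 2 * (if k = i then 1 else 0)
          - g p i 2 * g p l 2 * (if k = j then 1 else 0)
          + (g p j l * g p i 2 - g p i l * g p j 2) * (if k = 2 then 1 else 0))) := 
      Finset.sum_congr rfl fun i _ => Finset.sum_congr rfl fun j _ => Finset.sum_congr rfl fun l _ =>
        hk i j l
    have hv : ∀ x : Pt 3, x k = (if k = 0 then 1 else 0) * x 0 + (if k = 1 then 1 else 0) * x 1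
        + (if k = 2 then 1 else 0) * x 2 := by
      intro x; fin_cases k <;> simp
    have hEz : Ez k = if k = 2 then 1 else 0 := by
      simp [Ez, Pi.single_apply]
    have hL : ((∑ i, ∑ j, fderiv ℝ (fun q => christoffel g q k i j) p v * w i * z j)
      + GamV g p v (GamV g p w z) k
      - (∑ i, ∑ j, fderiv ℝ (fun q => christoffel g q k i j) p w * v i * z j)
      - GamV g p w (GamV g p v z) k) = ∑ i, ∑ j, ∑ l, v i * w j * z l * (pd i (C k j l) p - pd j (C k i l) p
      + (C k i 0 p * C 0 j l p + C k i 1 p * C 1 j l p + C k i 2 p * C 2 j l p)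
      - (C k j 0 p * C 0 i l p + C k j 1 p * C 1 i l p + C k j 2 p * C 2 i l p)) := by
      simp only [GamV, hf, hC p hp, Fin.sum_univ_three]
      ring
    rw [hL, hsum]
    simp only [Pi.add_apply, Pi.sub_apply, Pi.smul_apply, smul_eq_mul, hEz]
    rw [hv v, hv w]
    simp only [hz]
    simp only [gip, Fin.sum_univ_three]
    ring

section rules
variable {n : ℕ} {f h : Pt n → ℝ} {p : Pt n} {i : Fin n}
lemma dd_mul (hf : DifferentiableAt ℝ f p) (hh : DifferentiableAt ℝ h p) :
    pd i (fun q => f q * h q) p = pd i f p * h p + f p * pd i h p := by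
  rw [pd, fderiv_fun_mul hf hh]
  simp only [add_apply, smul_apply, smul_eq_mul]
  ring
lemma dd_add (hf : DifferentiableAt ℝ f p) (hh : DifferentiableAt ℝ h p) :
    pd i (fun q => f q + h q) p = pd i f p + pd i h p := by
  rw [pd, fderiv_fun_add hf hh]; rfl
lemma dd_sub (hf : DifferentiableAt ℝ f p) (hh : DifferentiableAt ℝ h p) :
    pd i (fun q => f q - h q) p = pd i f p - pd i h p := by
  rw [pd, fderiv_fun_sub hf hh]; rfl
lemma dd_neg : pd i (fun q => - f q) p = - pd i f p := by
  rw [pd, fderiv_fun_neg]; rfl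
lemma dd_const (c : ℝ) : pd i (fun _ => c) p = 0 := by simp [pd]
lemma dd_coord (j : Fin n) : pd i (fun q => q j) p = if j = i then 1 else 0 := by
  have : (fun q : Pt n => q j) = (ContinuousLinearMap.proj (R := ℝ) (φ := fun _ : Fin n => ℝ) j) := rfl
  rw [pd, this, ContinuousLinearMap.fderiv]
  simp [Pi.single_apply]
lemma dd_inv (hf : DifferentiableAt ℝ f p) (h0 : f p ≠ 0) :
    pd i (fun q => (f q)⁻¹) p = - (pd i f p) * ((f p)⁻¹ * (f p)⁻¹) := by
  have h1 : HasFDerivAt (fun q => (f q)⁻¹) _ p := (hasDerivAt_inv h0).comp_hasFDerivAt p hf.hasFDerivAt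
  rw [pd, h1.fderiv]
  simp
  field_simp
lemma dd_exp (hf : DifferentiableAt ℝ f p) :
    pd i (fun q => Real.exp (f q)) p = Real.exp (f p) * pd i f p := by
  rw [pd, hf.hasFDerivAt.exp.fderiv]; simp
end rules

/-! BCV -/
def rF (m : ℝ) (p : Pt 3) : ℝ := (1 + m * (p 0 * p 0 + p 1 * p 1))⁻¹

def gB (m c : ℝ) : Met 3 := fun p => Matrix.of
  ![![rF m p * rF m p + c * c * (p 1 * p 1) * (rF m p * rF m p),
      -(c * c * (p 0 * p 1) * (rF m p * rF m p)), c * p 1 * rF m p],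
    ![-(c * c * (p 0 * p 1) * (rF m p * rF m p)),
      rF m p * rF m p + c * c * (p 0 * p 0) * (rF m p * rF m p), -(c * p 0 * rF m p)],
    ![c * p 1 * rF m p, -(c * p 0 * rF m p), 1]]

lemma bcv_eq (m l : ℝ) : bcvMet m l = gB m (l / 2) := by
  ext p i j
  have hF : bcvF m p = 1 + m * (p 0 * p 0 + p 1 * p 1) := by simp only [bcvF]; ring
  fin_cases i <;> fin_cases j <;> simp [bcvMet, gB, bcvω, rF, hF, div_eq_mul_inv] <;>
    generalize 1 + m * (p 0 * p 0 + p 1 * p 1) = F <;> (try rw [← inv_pow]) <;> ring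

def VB (m : ℝ) : Set (Pt 3) := {p | 1 + m * (p 0 * p 0 + p 1 * p 1) ≠ 0}

lemma VB_open (m : ℝ) : IsOpen (VB m) := by
  apply isOpen_ne_fun <;> fun_prop

lemma rF_sm {m : ℝ} {p : Pt 3} (hp : p ∈ VB m) : SmAt (rF m) p := by
  exact ContDiffAt.inv (f := fun q : Pt 3 => 1 + m * (q 0 * q 0 + q 1 * q 1)) (by fun_prop) hp

lemma rF_pd {m : ℝ} {p : Pt 3} (hp : p ∈ VB m) (i : Fin 3) : pd i (rF m) p =
    if i = 0 then -(2 * m * p 0) * (rF m p * rF m p) else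
    if i = 1 then -(2 * m * p 1) * (rF m p * rF m p) else 0 := by
  have h := dd_inv (i := i) (f := fun q : Pt 3 => 1 + m * (q 0 * q 0 + q 1 * q 1)) (p := p)
    (by fun_prop) hp
  have : pd i (rF m) p = _ := h
  rw [this]
  simp (disch := fun_prop) only [dd_add, dd_mul, dd_const, dd_coord]
  fin_cases i <;> simp [rF, -mul_eq_mul_right_iff, -mul_eq_mul_left_iff] <;> ring

lemma gB_sm {m c : ℝ} {p : Pt 3} (hp : p ∈ VB m) (i j : Fin 3) : SmAt (fun q => gB m c q i j) p := by
  have := rF_sm hp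
  unfold SmAt at *
  fin_cases i <;> fin_cases j <;> simp [gB] <;> fun_prop

lemma gB_symm (m c : ℝ) (p : Pt 3) (i j : Fin 3) : gB m c p i j = gB m c p j i := by
  fin_cases i <;> fin_cases j <;> simp [gB]

lemma gB_det {m c : ℝ} {p : Pt 3} (hp : p ∈ VB m) : (gB m c p).det ≠ 0 := by
  have : (gB m c p).det = rF m p ^ 4 := by
    rw [Matrix.det_fin_three]; simp [gB]; ring
  rw [this]
  exact pow_ne_zero _ (inv_ne_zero hp)

def CB (m c : ℝ) : Fin 3 → Fin 3 → Fin 3 → Pt 3 → ℝ :=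
  ![![![fun p => -2 * m * (p 0 * rF m p), fun p => (c * c - 2 * m) * (p 1 * rF m p), fun _ => 0],
      ![fun p => (c * c - 2 * m) * (p 1 * rF m p), fun p => (2 * m - 2 * c * c) * (p 0 * rF m p),
        fun _ => c],
      ![fun _ => 0, fun _ => c, fun _ => 0]],
    ![![fun p => (2 * m - 2 * c * c) * (p 1 * rF m p), fun p => (c * c - 2 * m) * (p 0 * rF m p),
        fun _ => -c],
      ![fun p => (c * c - 2 * m) * (p 0 * rF m p), fun p => -2 * m * (p 1 * rF m p), fun _ => 0],
      ![fun _ => -c, fun _ => 0, fun _ => 0]],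
    ![![fun p => (2 * c * m - 2 * c * c * c) * (p 0 * p 1 * (rF m p * rF m p)),
        fun p => (c * c * c - c * m) * ((p 0 * p 0 - p 1 * p 1) * (rF m p * rF m p)),
        fun p => -(c * c) * (p 0 * rF m p)],
      ![fun p => (c * c * c - c * m) * ((p 0 * p 0 - p 1 * p 1) * (rF m p * rF m p)),
        fun p => -(2 * c * m - 2 * c * c * c) * (p 0 * p 1 * (rF m p * rF m p)),
        fun p => -(c * c) * (p 1 * rF m p)],
      ![fun p => -(c * c) * (p 0 * rF m p), fun p => -(c * c) * (p 1 * rF m p), fun _ => 0]]]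

set_option maxHeartbeats 2000000 in
lemma gB_chris {m c : ℝ} {p : Pt 3} (hp : p ∈ VB m) (k i j : Fin 3) :
    christoffel (gB m c) p k i j = CB m c k i j p := by
  apply chris_of_low (gB_det hp) (C := fun k => CB m c k i j p)
  intro l
  have hr := (rF_sm hp).da
  have hF : 1 + m * (p 0 * p 0 + p 1 * p 1) ≠ 0 := hp
  have h1 : rF m p * (1 + m * (p 0 * p 0 + p 1 * p 1)) = 1 := inv_mul_cancel₀ hF
  simp only [lowC, Fin.sum_univ_three]
  fin_cases l <;> fin_cases i <;> fin_cases j <;>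
    simp (disch := fun_prop) [gB, CB, dd_add, dd_mul, dd_sub, dd_neg, dd_const, dd_coord, rF_pd hp, -fderiv_fun_const, -fderiv_const] <;>
    simp only [rF] <;> field_simp <;> ring

set_option maxHeartbeats 4000000 in
lemma gB_curv (m c : ℝ) : CurvForm (gB m c) (VB m) (4 * m - 3 * c * c) (4 * c * c - 4 * m) := by
  apply curvForm_of (VB_open m) (fun p hp => gB_sm hp) (gB_symm m c) (fun p hp => gB_det hp)
    (fun p _ => by simp [gB]) _ _ (CB m c) (fun p hp => gB_chris hp)
  intro p hp
  have hr := (rF_sm hp).da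
  have hF : 1 + m * (p 0 * p 0 + p 1 * p 1) ≠ 0 := hp
  have key : ∀ k l : Fin 3, ∀ i j : Fin 3, i < j → pd i (CB m c k j l) p - pd j (CB m c k i l) p
      + (CB m c k i 0 p * CB m c 0 j l p + CB m c k i 1 p * CB m c 1 j l p + CB m c k i 2 p * CB m c 2 j l p)
      - (CB m c k j 0 p * CB m c 0 i l p + CB m c k j 1 p * CB m c 1 i l p + CB m c k j 2 p * CB m c 2 i l p)
      = (4 * m - 3 * c * c) * (gB m c p j l * (if k = i then 1 else 0) - gB m c p i l * (if k = j then 1 else 0))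
       + (4 * c * c - 4 * m) * (gB m c p j 2 * gB m c p l 2 * (if k = i then 1 else 0)
          - gB m c p i 2 * gB m c p l 2 * (if k = j then 1 else 0)
          + (gB m c p j l * gB m c p i 2 - gB m c p i l * gB m c p j 2) * (if k = 2 then 1 else 0)) := by
    intro k l i j hij
    have : (i = 0 ∧ j = 1) ∨ (i = 0 ∧ j = 2) ∨ (i = 1 ∧ j = 2) := by
      revert i j; decide
    rcases this with ⟨rfl, rfl⟩ | ⟨rfl, rfl⟩ | ⟨rfl, rfl⟩ <;> fin_cases k <;> fin_cases l <;>
    simp (disch := fun_prop) [gB, CB, dd_add, dd_mul, dd_sub, dd_neg, dd_const, dd_coord, rF_pd hp, -fderiv_fun_const, -fderiv_const] <;>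
    (try simp only [rF]) <;> field_simp <;> ring
  intro k i j l
  rcases lt_trichotomy i j with h | h | h
  · exact key k l i j h
  · subst h; ring
  · linear_combination -(key k l j i h)

lemma gip_low {g : Met 3} (hs : ∀ p i j, g p i j = g p j i) {p : Pt 3} (hd : (g p).det ≠ 0)
    (v w : Pt 3) : gip g p v (GamV g p w Ez) = ∑ l, ∑ i, lowC g p l i 2 * w i * v l := by
  rw [gip_symm hs, gip_Gam hs p _ _ _ hd]
  refine Finset.sum_congr rfl fun l _ => Finset.sum_congr rfl fun i _ => ?_
  simp [Ez, Fin.sum_univ_three]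

lemma gB_killing {m c : ℝ} {p : Pt 3} (hp : p ∈ VB m) (v w : Pt 3) :
    gip (gB m c) p v (GamV (gB m c) p w Ez) + gip (gB m c) p w (GamV (gB m c) p v Ez) = 0 := by
  rw [gip, gip]
  simp only [GamV, gB_chris hp, Fin.sum_univ_three]
  simp [gB, CB, Ez]
  ring

lemma gB_parallel {m : ℝ} {p : Pt 3} (hp : p ∈ VB m) (v w : Pt 3) :
    gip (gB m 0) p v (GamV (gB m 0) p w Ez) = 0 := by
  rw [gip]
  simp only [GamV, gB_chris hp, Fin.sum_univ_three]
  simp [gB, CB, Ez]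

lemma gB_deg {m c : ℝ} {φ : Pt 2 → Pt 3} {u : Pt 2} (h : φ u ∉ VB m) :
    (fff (gB m c) φ u).det = 0 := by
  have h0 : 1 + m * (φ u 0 * φ u 0 + φ u 1 * φ u 1) = 0 := by
    by_contra h1; exact h h1
  have hr : rF m (φ u) = 0 := by simp [rF, h0]
  have hg : ∀ a b, fff (gB m c) φ u a b = dmap φ u a 2 * dmap φ u b 2 := by
    intro a b
    simp [fff, gip, gB, hr, Fin.sum_univ_three]
  rw [Matrix.det_fin_two]
  simp only [hg]; ring

lemma VB_univ {m : ℝ} (hm : 0 ≤ m) (p : Pt 3) : p ∈ VB m := by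
  have : 0 ≤ m * (p 0 * p 0 + p 1 * p 1) := by
    have := mul_self_nonneg (p 0); have := mul_self_nonneg (p 1); positivity
  show 1 + _ ≠ 0
  linarith

/-! diagonal metrics -/
def gD (f h : Pt 3 → ℝ) : Met 3 := fun p => Matrix.of ![![f p, 0, 0], ![0, h p, 0], ![0, 0, 1]]

def gE (s t : ℝ) : Met 3 := gD (fun p => Real.exp (s * p 2)) (fun p => Real.exp (t * p 2))

lemma eucl_eq : euclMet = gE 0 0 := by
  ext p i j
  fin_cases i <;> fin_cases j <;> simp [euclMet, gE, gD]
lemma hyp_eq : hypMet = gE 2 2 := by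
  ext p i j
  fin_cases i <;> fin_cases j <;> simp [hypMet, gE, gD]
lemma sol_eq : solMet = gE 2 (-2) := by
  ext p i j
  fin_cases i <;> fin_cases j <;> simp [solMet, gE, gD]

lemma gE_sm {s t : ℝ} {p : Pt 3} (i j : Fin 3) : SmAt (fun q => gE s t q i j) p := by
  unfold SmAt
  fin_cases i <;> fin_cases j <;> simp [gE, gD] <;> fun_prop

lemma gE_symm (s t : ℝ) (p : Pt 3) (i j : Fin 3) : gE s t p i j = gE s t p j i := by
  fin_cases i <;> fin_cases j <;> simp [gE, gD]

lemma gE_det {s t : ℝ} {p : Pt 3} : (gE s t p).det ≠ 0 := by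
  rw [Matrix.det_fin_three]; simp [gE, gD]

def CE (s t : ℝ) : Fin 3 → Fin 3 → Fin 3 → Pt 3 → ℝ :=
  ![![![fun _ => 0, fun _ => 0, fun _ => s / 2], ![fun _ => 0, fun _ => 0, fun _ => 0],
      ![fun _ => s / 2, fun _ => 0, fun _ => 0]],
    ![![fun _ => 0, fun _ => 0, fun _ => 0], ![fun _ => 0, fun _ => 0, fun _ => t / 2],
      ![fun _ => 0, fun _ => t / 2, fun _ => 0]],
    ![![fun p => -(s / 2) * Real.exp (s * p 2), fun _ => 0, fun _ => 0],
      ![fun _ => 0, fun p => -(t / 2) * Real.exp (t * p 2), fun _ => 0],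
      ![fun _ => 0, fun _ => 0, fun _ => 0]]]

set_option maxHeartbeats 2000000 in
lemma gE_chris {s t : ℝ} {p : Pt 3} (k i j : Fin 3) :
    christoffel (gE s t) p k i j = CE s t k i j p := by
  apply chris_of_low gE_det (C := fun k => CE s t k i j p)
  intro l
  simp only [lowC, Fin.sum_univ_three]
  fin_cases l <;> fin_cases i <;> fin_cases j <;>
    simp (disch := fun_prop) [gE, gD, CE, dd_exp, dd_mul, dd_const, dd_coord, -fderiv_fun_const, -fderiv_const] <;>
    ring

set_option maxHeartbeats 4000000 in
lemma gE_curv {s t a b : ℝ} (h1 : 4 * (a + b) = - s * s) (h2 : 4 * (a + b) = - t * t)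
    (h3 : 4 * a = - s * t) : CurvForm (gE s t) Set.univ a b := by
  apply curvForm_of isOpen_univ (fun p _ => gE_sm) (gE_symm s t) (fun p _ => gE_det)
    (fun p _ => by simp [gE, gD]) _ _ (CE s t) (fun p _ => gE_chris)
  intro p _
  have key : ∀ k l : Fin 3, ∀ i j : Fin 3, i < j → pd i (CE s t k j l) p - pd j (CE s t k i l) p
      + (CE s t k i 0 p * CE s t 0 j l p + CE s t k i 1 p * CE s t 1 j l p + CE s t k i 2 p * CE s t 2 j l p)
      - (CE s t k j 0 p * CE s t 0 i l p + CE s t k j 1 p * CE s t 1 i l p + CE s t k j 2 p * CE s t 2 i l p)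
      = a * (gE s t p j l * (if k = i then 1 else 0) - gE s t p i l * (if k = j then 1 else 0))
       + b * (gE s t p j 2 * gE s t p l 2 * (if k = i then 1 else 0)
          - gE s t p i 2 * gE s t p l 2 * (if k = j then 1 else 0)
          + (gE s t p j l * gE s t p i 2 - gE s t p i l * gE s t p j 2) * (if k = 2 then 1 else 0)) := by
    intro k l i j hij
    have : (i = 0 ∧ j = 1) ∨ (i = 0 ∧ j = 2) ∨ (i = 1 ∧ j = 2) := by
      revert i j; decide
    have e1 : a = -s * t / 4 := by linarith
    have e2 : b = (-s * s + s * t)/4 := by linarith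
    have e4 : s * s = t * t := by linarith
    rcases this with ⟨rfl, rfl⟩ | ⟨rfl, rfl⟩ | ⟨rfl, rfl⟩ <;> fin_cases k <;> fin_cases l <;>
    simp (disch := fun_prop) [gE, gD, CE, dd_exp, dd_mul, dd_neg, dd_const, dd_coord, -fderiv_fun_const, -fderiv_const] <;>
    generalize Real.exp (s * p 2) = X <;> generalize Real.exp (t * p 2) = Y <;>
    grind
  intro k i j l
  rcases lt_trichotomy i j with h | h | h
  · exact key k l i j h
  · subst h; ring
  · linear_combination -(key k l j i h)

lemma gB_fff_det {m c : ℝ} {φ : Pt 2 → Pt 3} (imm : IsImmersion φ) {u : Pt 2} (h : φ u ∈ VB m) :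
    (fff (gB m c) φ u).det ≠ 0 := by
  intro hd
  obtain ⟨x, hx, hx0⟩ := Matrix.exists_mulVec_eq_zero_iff.mpr hd
  set w : Pt 3 := fun k => x 0 * dmap φ u 0 k + x 1 * dmap φ u 1 k with hw
  have hr : rF m (φ u) ≠ 0 := inv_ne_zero h
  have e0 := congrFun hx0 0
  have e1 := congrFun hx0 1
  simp only [Matrix.mulVec, dotProduct, Fin.sum_univ_two, Pi.zero_apply] at e0 e1
  have hg : gip (gB m c) (φ u) w w = 0 := by
    have : gip (gB m c) (φ u) w w = x 0 * (fff (gB m c) φ u 0 0 * x 0 + fff (gB m c) φ u 0 1 * x 1)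
        + x 1 * (fff (gB m c) φ u 1 0 * x 0 + fff (gB m c) φ u 1 1 * x 1) := by
      simp only [fff, Matrix.of_apply, gip, Fin.sum_univ_three, hw]
      ring
    rw [this, e0, e1]; ring
  have hg2 : gip (gB m c) (φ u) w w = (rF m (φ u) * w 0) ^ 2 + (rF m (φ u) * w 1) ^ 2 +
      (w 2 + c * rF m (φ u) * (φ u 1 * w 0 - φ u 0 * w 1)) ^ 2 := by
    simp [gip, Fin.sum_univ_three, gB]; ring
  rw [hg2] at hg
  have q0 := sq_nonneg (rF m (φ u) * w 0)
  have q1 := sq_nonneg (rF m (φ u) * w 1)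
  have q2 := sq_nonneg (w 2 + c * rF m (φ u) * (φ u 1 * w 0 - φ u 0 * w 1))
  have w0 : w 0 = 0 := by
    have : rF m (φ u) * w 0 = 0 := pow_eq_zero_iff (two_ne_zero) |>.mp (by linarith)
    exact (mul_eq_zero.mp this).resolve_left hr
  have w1 : w 1 = 0 := by
    have : rF m (φ u) * w 1 = 0 := pow_eq_zero_iff (two_ne_zero) |>.mp (by linarith)
    exact (mul_eq_zero.mp this).resolve_left hr
  have w2 : w 2 = 0 := by
    have : (w 2 + c * rF m (φ u) * (φ u 1 * w 0 - φ u 0 * w 1)) = 0 :=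
      pow_eq_zero_iff (two_ne_zero) |>.mp (by linarith)
    rw [w0, w1] at this; linarith
  have hli := imm.2 u
  rw [Fintype.linearIndependent_iff] at hli
  have hs : ∑ i, x i • dmap φ u i = 0 := by
    ext k
    have : w k = 0 := by fin_cases k <;> assumption
    simpa [Fin.sum_univ_two, hw] using this
  exact hx (funext (hli x hs))

lemma gB_none {m c : ℝ} {φ ξ : Pt 2 → Pt 3} (imm : IsImmersion φ) (nor : IsUnitNormal (gB m c) φ ξ)
    (humb : IsTotallyUmbilical (gB m c) φ ξ) (hm : m ≠ c * c)
    (h : (c = 0) ∨ 4 * m - 2 * c * c ≤ 0)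
    (hP : IsProperBiharmonic (gB m c) φ) : False := by
  obtain ⟨lam, umb⟩ := humb
  refine hP.2 (no_proper (VB_open m) (fun p hp => gB_sm hp) (gB_symm m c) (fun p hp => gB_det hp)
    imm nor umb (fun u hu => gB_deg hu) ?_)
  intro U S u hu
  have hb : 4 * c * c - 4 * m ≠ 0 := fun h => hm (by linarith)
  rcases h with rfl | h
  · exact S.parallel (gB_curv m 0) hP.1 hb (by linarith) (fun p hp => gB_parallel hp) hu
  · exact S.killing (gB_curv m c) hP.1 hb (by linarith) (fun p hp => gB_killing hp) hu

lemma gE_none {s t a b : ℝ} {φ ξ : Pt 2 → Pt 3} (imm : IsImmersion φ) (nor : IsUnitNormal (gE s t) φ ξ)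
    (humb : IsTotallyUmbilical (gE s t) φ ξ) (h1 : 4 * (a + b) = - s * s) (h2 : 4 * (a + b) = - t * t)
    (h3 : 4 * a = - s * t) (h : (b = 0 ∧ a ≤ 0) ∨ (b ≠ 0 ∧ 2 * a + b ≤ 0 ∧ a + b ≤ 0))
    (hP : IsProperBiharmonic (gE s t) φ) : False := by
  obtain ⟨lam, umb⟩ := humb
  refine hP.2 (no_proper isOpen_univ (fun p hp => gE_sm) (gE_symm s t) (fun p hp => gE_det)
    imm nor umb (fun u hu => absurd (Set.mem_univ _) hu) ?_)
  intro U S u hu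
  have hR := gE_curv h1 h2 h3
  by_contra hl
  have hp : 0 < lam u ^ 2 := by positivity
  rcases h with ⟨rfl, h⟩ | ⟨hb, h, h'⟩
  · have := S.fwd2 hR hP.1 hu hl
    linarith
  · rcases S.fwd3 hR hP.1 hb hu hl with ⟨_, e⟩ | ⟨_, _, e⟩ <;> linarith

lemma sphere {φ ξ : Pt 2 → Pt 3} (imm : IsImmersion φ) (nor : IsUnitNormal (gB 1 1) φ ξ)
    (humb : IsTotallyUmbilical (gB 1 1) φ ξ) :
    IsProperBiharmonic (gB 1 1) φ ↔ ∀ u, meanCurv (gB 1 1) φ ξ u ^ 2 = 1 := by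
  obtain ⟨lam, umb⟩ := humb
  have S := mkSetup (VB_open 1) (fun p hp => gB_sm hp) (gB_symm 1 1) (fun p hp => gB_det hp)
    imm nor umb
  have hu : ∀ u, u ∈ {u | φ u ∈ VB 1 ∧ (fff (gB 1 1) φ u).det ≠ 0} := fun u =>
    ⟨VB_univ zero_le_one _, gB_fff_det imm (VB_univ zero_le_one _)⟩
  have hR : CurvForm (gB 1 1) (VB 1) 1 0 := by
    have := gB_curv 1 1
    norm_num at this
    exact this
  have hc : ∀ u c, pd c lam u = 0 := fun u c => by
    rw [S.codazzi hR (hu u) c]; ring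
  have hdf : ∀ u, fderiv ℝ lam u = 0 := by
    intro u
    ext v
    have : v = v 0 • (Pi.single 0 1 : Pt 2) + v 1 • (Pi.single 1 1 : Pt 2) := by
      ext k; fin_cases k <;> simp
    rw [this, map_add, map_smul, map_smul]
    have h0 := hc u 0
    have h1 := hc u 1
    simp only [pd] at h0 h1
    rw [h0, h1]; simp
  have hconst : ∀ u v, lam u = lam v :=
    is_const_of_fderiv_eq_zero (fun u => (S.lam_sm (hu u)).da) hdf
  have hT := fun u => S.tens (hu u)
  constructor
  · rintro ⟨hB, hM⟩ u
    rw [S.mean (hu u)]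
    have hl : lam u ≠ 0 := by
      intro h0
      apply hM
      intro v
      rw [hT v, hconst v u, h0]; simp
    have := S.fwd2 hR hB (hu u) hl
    linarith
  · intro h
    have h' : ∀ u, lam u ^ 2 = 1 := fun u => by rw [← S.mean (hu u)]; exact h u
    refine ⟨?_, ?_⟩
    · intro u
      rw [S.bit hR (hu u), Setup.lap_zero (Filter.Eventually.of_forall hc)]
      have e : (2 * 0 - 4 * lam u ^ 3 + 2 * lam u *
          (2 * 1 + 0 * (1 + gip (gB 1 1) (φ u) (ξ u) Ez ^ 2))) = 0 := by
        linear_combination -4 * lam u * h' u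
      rw [e]
      simp [hc]
    · intro hM
      have h1 := hM 0
      rw [hT 0] at h1
      have h2 := congrArg (fun W => gip (gB 1 1) (φ 0) W (ξ 0)) h1
      have h0 : gip (gB 1 1) (φ 0) 0 (ξ 0) = 0 := by simp [gip]
      simp only [gip_smul_left, nor.2.1, h0] at h2
      have h3 : lam 0 = 0 := by linarith
      have := h' 0
      rw [h3] at this
      norm_num at this

lemma main_fwd {g : Met 3}
    (hg : g = euclMet ∨ g = hypMet ∨ g = bcvMet (1 / 4) 0 ∨
      g = bcvMet (-(1 / 4)) 0 ∨ g = bcvMet (-(1 / 4)) 1 ∨ g = bcvMet 0 1 ∨ g = solMet)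
    {φ ξ : Pt 2 → Pt 3} (hφ : IsImmersion φ) (hξ : IsUnitNormal g φ ξ)
    (humb : IsTotallyUmbilical g φ ξ) (hP : IsProperBiharmonic g φ) : False := by
  rw [eucl_eq, hyp_eq, sol_eq] at hg
  simp only [bcv_eq] at hg
  rcases hg with rfl | rfl | rfl | rfl | rfl | rfl | rfl
  · exact gE_none (a := 0) (b := 0) hφ hξ humb (by norm_num) (by norm_num) (by norm_num)
      (by norm_num) hP
  · exact gE_none (a := -1) (b := 0) hφ hξ humb (by norm_num) (by norm_num) (by norm_num)
      (by norm_num) hP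
  · exact gB_none hφ hξ humb (by norm_num) (by norm_num) hP
  · exact gB_none hφ hξ humb (by norm_num) (by norm_num) hP
  · exact gB_none hφ hξ humb (by norm_num) (by norm_num) hP
  · exact gB_none hφ hξ humb (by norm_num) (by norm_num) hP
  · exact gE_none (a := 1) (b := -2) hφ hξ humb (by norm_num) (by norm_num) (by norm_num)
      (by norm_num) hP

lemma main_sph {φ ξ : Pt 2 → Pt 3} (imm : IsImmersion φ) (nor : IsUnitNormal (bcvMet 1 2) φ ξ)
    (humb : IsTotallyUmbilical (bcvMet 1 2) φ ξ) :
    IsProperBiharmonic (bcvMet 1 2) φ ↔ ∀ u, meanCurv (bcvMet 1 2) φ ξ u ^ 2 = 1 := by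
  have e : bcvMet 1 2 = gB 1 1 := by rw [bcv_eq]; norm_num
  rw [e] at nor humb ⊢
  exact sphere imm nor humb

/-- Theorem 3.6. A totally umbilical surface in any of Thurston's eight
3-dimensional geometries — `ℝ³` (`euclMet`), `S³` (= `bcvMet 1 2`, the round `S³(1)` in BCV
form), `H³` (`hypMet`), `S² × ℝ` (= `bcvMet (1/4) 0`), `H² × ℝ` (= `bcvMet (-(1/4)) 0`),
`SL~(2,ℝ)` (= `bcvMet (-(1/4)) 1`), `Nil` (= `bcvMet 0 1`) and `Sol` (`solMet`) — is
proper biharmonic if and only if it is a part of `S²(1/√2)` in `S³`; among totally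
umbilical surfaces in `S³` these are exactly the ones with `H² = 1`. -/
theorem totally_umbilical_proper_biharmonic_in_Thurston_geometries
    (g : Met 3)
    (hg : g = euclMet ∨ g = bcvMet 1 2 ∨ g = hypMet ∨ g = bcvMet (1 / 4) 0 ∨
      g = bcvMet (-(1 / 4)) 0 ∨ g = bcvMet (-(1 / 4)) 1 ∨ g = bcvMet 0 1 ∨ g = solMet)
    (φ ξ : Pt 2 → Pt 3) (hφ : IsImmersion φ) (hξ : IsUnitNormal g φ ξ)
    (humb : IsTotallyUmbilical g φ ξ) :
    IsProperBiharmonic g φ ↔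
      g = bcvMet 1 2 ∧ ∀ u, meanCurv g φ ξ u ^ 2 = 1 := by
  constructor
  · intro hP
    by_cases h : g = bcvMet 1 2
    · subst h
      exact ⟨rfl, (main_sph hφ hξ humb).mp hP⟩
    · refine (main_fwd ?_ hφ hξ humb hP).elim
      tauto
  · rintro ⟨rfl, h⟩
    exact (main_sph hφ hξ humb).mpr h
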